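/- Let 1 ≤ k̄ ≤ L/2. Every local conserved quantity of the quantum compass Hamiltonian H with diagonal length k̄ is a constant (nonzero scalar) multiple of H. In particular, for k̄ ≠ 2 no local conserved quantity with diagonal length k̄ exists. -/

import Mathlib

open Complex Matrix

/-- Sites of the `L × L` square lattice with periodic boundary conditions. -/
abbrev Site (L : ℕ) := ZMod L × ZMod L

/-- A specification of a product of Pauli matrices: at each site either
`0` (no operator), `1` (`X`), `2` (`Y`) or `3` (`Z`). -/
abbrev PSpec (L : ℕ) := Site L → Fin 4

/-- Operators on the Hilbert space `⊗_{u ∈ Λ} ℂ²`. -/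
abbrev Op (L : ℕ) := Matrix (Site L → Fin 2) (Site L → Fin 2) ℂ

/-- The Pauli matrices (`0` gives the identity). -/
noncomputable def pauli (w : Fin 4) : Matrix (Fin 2) (Fin 2) ℂ :=
  if w = 1 then !![0, 1; 1, 0]
  else if w = 2 then !![0, -Complex.I; Complex.I, 0]
  else if w = 3 then !![1, 0; 0, -1]
  else 1

/-- The product of Pauli matrices specified by `σ`, as an operator (matrix)
on the full Hilbert space. -/
noncomputable def PauliOp (L : ℕ) [NeZero L] (σ : PSpec L) : Op L :=
  fun s t => ∏ u : Site L, pauli (σ u) (s u) (t u)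

/-- `DiagBoundAt L σ a k` : every site `u` in the support of `σ` satisfies
`0 ≤ uₓ + u_y − a ≤ k − 1 (mod L)`. -/
def DiagBoundAt (L : ℕ) (σ : PSpec L) (a : ZMod L) (k : ℕ) : Prop :=
  ∀ u : Site L, σ u ≠ 0 → (u.1 + u.2 - a).val < k

/-- The diagonal length of a Pauli product. -/
noncomputable def Diag (L : ℕ) (σ : PSpec L) : ℕ :=
  sInf {k | ∃ a : ZMod L, DiagBoundAt L σ a k}

/-- `X_u` as a Pauli-product specification. -/
def sigX (L : ℕ) (u : Site L) : PSpec L := fun v => if v = u then 1 else 0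
/-- `Y_u` as a Pauli-product specification. -/
def sigY (L : ℕ) (u : Site L) : PSpec L := fun v => if v = u then 2 else 0
/-- `Z_u` as a Pauli-product specification. -/
def sigZ (L : ℕ) (u : Site L) : PSpec L := fun v => if v = u then 3 else 0
/-- A single-site Pauli operator `W_u` (`w ∈ {1,2,3}`). -/
def sigW (L : ℕ) (u : Site L) (w : Fin 4) : PSpec L := fun v => if v = u then w else 0

/-- `X_u X_{u+eₓ}` as a Pauli-product specification. -/
def sigXX (L : ℕ) (u : Site L) : PSpec L :=
  fun v => if v = u then 1 else if v = u + (1, 0) then 1 else 0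
/-- `Y_u Y_{u+e_y}` as a Pauli-product specification. -/
def sigYY (L : ℕ) (u : Site L) : PSpec L :=
  fun v => if v = u then 2 else if v = u + (0, 1) then 2 else 0

/-- The quantum compass Hamiltonian
`H = −Σ_u (Jx X_u X_{u+eₓ} + Jy Y_u Y_{u+e_y})`. -/
noncomputable def Hcompass (L : ℕ) [NeZero L] (Jx Jy : ℝ) : Op L :=
  - ∑ u : Site L, ((Jx : ℂ) • PauliOp L (sigXX L u) + (Jy : ℂ) • PauliOp L (sigYY L u))

/-- The quantum compass Hamiltonian with a uniform magnetic field. -/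
noncomputable def Hfield (L : ℕ) [NeZero L] (Jx Jy hx hy hz : ℝ) : Op L :=
  - ∑ u : Site L,
      ((Jx : ℂ) • PauliOp L (sigXX L u) + (Jy : ℂ) • PauliOp L (sigYY L u)
        + (hx : ℂ) • PauliOp L (sigX L u) + (hy : ℂ) • PauliOp L (sigY L u)
        + (hz : ℂ) • PauliOp L (sigZ L u))

/-- The candidate conserved quantity `Q = Σ_σ q_σ σ`. -/
noncomputable def Qop (L : ℕ) [NeZero L] (q : PSpec L → ℂ) : Op L :=
  ∑ σ : PSpec L, q σ • PauliOp L σ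

/-- Commutator of operators. -/
noncomputable def opComm (L : ℕ) [NeZero L] (A B : Op L) : Op L := A * B - B * A

/-- The coefficient `λ_{σ,τ}` of the Pauli product `τ` in the expansion
`[H, σ] = Σ_τ λ_{σ,τ} τ`, extracted via the (normalized) trace inner product. -/
noncomputable def lam (L : ℕ) [NeZero L] (H : Op L) (σ τ : PSpec L) : ℂ :=
  Matrix.trace (PauliOp L τ * opComm L H (PauliOp L σ)) / (2 ^ Fintype.card (Site L))

/-- `u` is a top-right site of `σ` (relative to the witness `a` for diagonal
length `k`). -/
def IsTopRight (L : ℕ) (σ : PSpec L) (a : ZMod L) (k : ℕ) (u : Site L) : Prop :=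
  σ u ≠ 0 ∧ (u.1 + u.2 - a).val = k - 1

/-- `u` is a bottom-left site of `σ` (relative to the witness `a`). -/
def IsBottomLeft (L : ℕ) (σ : PSpec L) (a : ZMod L) (u : Site L) : Prop :=
  σ u ≠ 0 ∧ (u.1 + u.2 - a).val = 0

/-- Condition (1): `σ` has a unique top-right site `ū`, with
(1a) `σ_ū = X` and `ū − eₓ ∈ Supp σ`, or (1b) `σ_ū = Y` and `ū − e_y ∈ Supp σ`. -/
def Cond1 (L : ℕ) (σ : PSpec L) (a : ZMod L) (k : ℕ) : Prop :=
  ∃ ub : Site L, (∀ v : Site L, IsTopRight L σ a k v ↔ v = ub) ∧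
    ((σ ub = 1 ∧ σ (ub - (1, 0)) ≠ 0) ∨ (σ ub = 2 ∧ σ (ub - (0, 1)) ≠ 0))

/-- Condition (2): `σ` has a unique bottom-left site `u̲`, with
(2a) `σ_u̲ = X` and `u̲ + eₓ ∈ Supp σ`, or (2b) `σ_u̲ = Y` and `u̲ + e_y ∈ Supp σ`. -/
def Cond2 (L : ℕ) (σ : PSpec L) (a : ZMod L) : Prop :=
  ∃ lb : Site L, (∀ v : Site L, IsBottomLeft L σ a v ↔ v = lb) ∧
    ((σ lb = 1 ∧ σ (lb + (1, 0)) ≠ 0) ∨ (σ lb = 2 ∧ σ (lb + (0, 1)) ≠ 0))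

/-- `ShiftRel L k σ σ'` : `σ` has diagonal length `k`, satisfies conditions (1)
and (2), and `σ'` is the Shiraishi shift `S(σ)`, obtained by first appending a
site at the top right (the product `B`) and then truncating the bottom-left site. -/
def ShiftRel (L : ℕ) [NeZero L] (k : ℕ) (σ σ' : PSpec L) : Prop :=
  Diag L σ = k ∧ σ' ≠ 0 ∧
  ∃ a : ZMod L, DiagBoundAt L σ a k ∧
  ∃ ub lb : Site L,
    (∀ v : Site L, IsTopRight L σ a k v ↔ v = ub) ∧
    (∀ v : Site L, IsBottomLeft L σ a v ↔ v = lb) ∧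
    ∃ B : Op L,
      ((σ ub = 1 ∧ σ (ub - (1, 0)) ≠ 0 ∧
          B = (-(1 / (2 * Complex.I))) • opComm L (PauliOp L (sigYY L ub)) (PauliOp L σ)) ∨
       (σ ub = 2 ∧ σ (ub - (0, 1)) ≠ 0 ∧
          B = (1 / (2 * Complex.I)) • opComm L (PauliOp L (sigXX L ub)) (PauliOp L σ))) ∧
      ∃ ε : ℂ, (ε = 1 / (2 * Complex.I) ∨ ε = -(1 / (2 * Complex.I))) ∧
        ((σ lb = 1 ∧ σ (lb + (1, 0)) ≠ 0 ∧
            PauliOp L σ' = ε • opComm L (PauliOp L (sigXX L lb)) B) ∨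
         (σ lb = 2 ∧ σ (lb + (0, 1)) ≠ 0 ∧
            PauliOp L σ' = ε • opComm L (PauliOp L (sigYY L lb)) B))

/-- The staircase sequence `u_j`: `u_j = u₁ + ((j−1)/2)(eₓ+e_y)` for odd `j`,
and `u_j = u₁ + (j/2)(eₓ+e_y) − e_y` for even `j`. -/
def stair (L : ℕ) (u1 : Site L) (j : ℕ) : Site L :=
  if j % 2 = 1 then
    u1 + ((((j - 1) / 2 : ℕ) : ZMod L), (((j - 1) / 2 : ℕ) : ZMod L))
  else
    u1 + (((j / 2 : ℕ) : ZMod L), ((j / 2 : ℕ) : ZMod L)) - ((0 : ZMod L), (1 : ZMod L))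

/-- The Pauli letter at the first (bottom-left) end of `C^k_j`. -/
def endL (j : ℕ) : Fin 4 := if j % 2 = 1 then 1 else 2

/-- The Pauli letter at the last (top-right) end of `C^k_j`. -/
def endR (k j : ℕ) : Fin 4 :=
  if k % 2 = 1 then (if j % 2 = 1 then 2 else 1)
  else (if j % 2 = 1 then 1 else 2)

/-- The standard-form product `C^k_j` based at `u₁`: the appropriate end
letters at `u_j` and `u_{j+k−1}`, and `Z` at `u_{j+1}, …, u_{j+k−2}`. -/
def Cspec (L : ℕ) (k j : ℕ) (u1 : Site L) : PSpec L := fun v =>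
  if v = stair L u1 j then endL j
  else if v = stair L u1 (j + k - 1) then endR k j
  else if v ∈ (Finset.Icc (j + 1) (j + k - 2)).image (stair L u1) then 3
  else 0

/-- A Pauli letter written as the exponents of `X` and `Y`. -/
abbrev Letter := ZMod 2 × ZMod 2

/-- A Pauli product up to phase, written through the exponents of `X` and `Y`. -/
abbrev Cfg (L : ℕ) := Site L → Letter

/-- The letter `X` (for `false`) or `Y` (for `true`). -/
def letter (p : Bool) : Letter := if p then (0, 1) else (1, 0)

/-- The exponent that detects anticommutation with `letter p`. -/
def detect (p : Bool) (x : Letter) : ZMod 2 := if p then x.1 else x.2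

/-- The direction `eₓ` (for `false`) or `e_y` (for `true`). -/
def step (L : ℕ) (p : Bool) : Site L := if p then (0, 1) else (1, 0)

lemma letter_add_self (x : Letter) : x + x = 0 := by revert x; decide

lemma letter_ne_zero (p : Bool) : letter p ≠ 0 := by revert p; decide

lemma letter_injective {p p' : Bool} (h : letter p = letter p') : p = p' := by
  revert p p'; decide

lemma letter_ne_both (p : Bool) : letter p ≠ (1, 1) := by revert p; decide

lemma letter_add_letter_not (p : Bool) : letter p + letter (!p) = (1, 1) := by
  revert p; decide

lemma detect_letter (p : Bool) : detect p (letter p) = 0 := by revert p; decide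

lemma detect_letter_not (p : Bool) : detect (!p) (letter p) = 1 := by revert p; decide

lemma detect_both (p : Bool) : detect p (1, 1) = 1 := by revert p; decide

lemma detect_zero (p : Bool) : detect p 0 = 0 := by revert p; decide

lemma detect_add (p : Bool) (x y : Letter) : detect p (x + y) = detect p x + detect p y := by
  revert p x y; decide

lemma eq_not_of_detect_letter {p p' : Bool} (h : detect p (letter p') = 1) : p' = !p := by
  revert p p'; decide

lemma exists_detect {x : Letter} (h : x ≠ 0) : ∃ p, detect p x = 1 := by revert x; decide

lemma ne_zero_of_detect {p : Bool} {x : Letter} (h : detect p x = 1) : x ≠ 0 := by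
  revert p x; decide

lemma eq_of_add_letter_eq_zero {x y : Letter} (h : x + y = 0) : x = y := by
  revert x y; decide

section Lattice

variable {L : ℕ}

/-- The bond operator `X_u X_{u+eₓ}` or `Y_u Y_{u+e_y}`. -/
def bond (u : Site L) (p : Bool) : Cfg L :=
  fun s => if s = u ∨ s = u + step L p then letter p else 0

/-- The diagonal on which a site lies. -/
def diagOf (u : Site L) : ZMod L := u.1 + u.2

/-- `τ` anticommutes with the bond operator `(u, p)`. -/
def Anti (τ : Cfg L) (u : Site L) (p : Bool) : Prop :=
  detect p (τ u) + detect p (τ (u + step L p)) = 1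

/-- The support of `τ` meets the diagonal `d`. -/
def Occ (τ : Cfg L) (d : ZMod L) : Prop := ∃ u, diagOf u = d ∧ τ u ≠ 0

/-- The support of `τ` lies on the diagonals `a, …, a + k - 1`. -/
def Within (τ : Cfg L) (a : ZMod L) (k : ℕ) : Prop :=
  ∀ u, τ u ≠ 0 → ∃ n < k, diagOf u = a + (n : ZMod L)

lemma cast_inj_of_lt {m n : ℕ} (hm : m < L) (hn : n < L) (h : (m : ZMod L) = n) : m = n := by
  have := congrArg ZMod.val h
  rwa [ZMod.val_natCast_of_lt hm, ZMod.val_natCast_of_lt hn] at this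

lemma shift_inj_of_lt {a : ZMod L} {m n : ℕ} (hm : m < L) (hn : n < L)
    (h : a + (m : ZMod L) = a + n) : m = n :=
  cast_inj_of_lt hm hn (add_left_cancel h)

lemma diagOf_step (p : Bool) : diagOf (step L p) = 1 := by
  cases p <;> simp [diagOf, step]

lemma diagOf_add (u v : Site L) : diagOf (u + v) = diagOf u + diagOf v := by
  simp only [diagOf, Prod.fst_add, Prod.snd_add]; ring

lemma diagOf_add_step (u : Site L) (p : Bool) : diagOf (u + step L p) = diagOf u + 1 := by
  rw [diagOf_add, diagOf_step]

lemma one_ne_zero_of_lt (hL : 1 < L) : (1 : ZMod L) ≠ 0 := by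
  intro h
  have := cast_inj_of_lt (L := L) (m := 1) (n := 0) hL (by omega) (by simpa using h)
  omega

lemma add_step_ne (hL : 1 < L) (u : Site L) (p : Bool) : u + step L p ≠ u := by
  intro h
  have := congrArg diagOf h
  rw [diagOf_add_step] at this
  exact one_ne_zero_of_lt hL (by simpa using this)

lemma step_injective (hL : 1 < L) {p p' : Bool} (h : step L p = step L p') : p = p' := by
  have h1 := one_ne_zero_of_lt hL
  cases p <;> cases p' <;> simp_all [step]

lemma add_bond_self (τ : Cfg L) (u : Site L) (p : Bool) : τ + bond u p + bond u p = τ := by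
  funext s
  simp only [Pi.add_apply, add_assoc, letter_add_self, add_zero]

lemma bond_apply_left (u : Site L) (p : Bool) : bond u p u = letter p := by simp [bond]

lemma bond_apply_right (u : Site L) (p : Bool) : bond u p (u + step L p) = letter p := by
  simp [bond]

lemma bond_apply_eq_zero {u s : Site L} {p : Bool} (h : s ≠ u) (h' : s ≠ u + step L p) :
    bond u p s = 0 := by simp [bond, h, h']

lemma bond_apply_of_diag {u s : Site L} {p : Bool} (h : diagOf s ≠ diagOf u)
    (h' : diagOf s ≠ diagOf u + 1) : bond u p s = 0 :=
  bond_apply_eq_zero (fun e => h (by rw [e])) (fun e => h' (by rw [e, diagOf_add_step]))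

lemma detect_bond (u s : Site L) (p : Bool) : detect p (bond u p s) = 0 := by
  unfold bond; split
  · exact detect_letter p
  · exact detect_zero p

lemma detect_add_bond (τ : Cfg L) (u s : Site L) (p : Bool) :
    detect p ((τ + bond u p) s) = detect p (τ s) := by
  rw [Pi.add_apply, detect_add, detect_bond, add_zero]

lemma anti_add_bond (τ : Cfg L) (u : Site L) (p : Bool) :
    Anti (τ + bond u p) u p ↔ Anti τ u p := by
  simp only [Anti, detect_add_bond]

/-- A site emptied by a bond carried the letter of the bond and is one of its ends. -/
lemma emptied {τ : Cfg L} {u s : Site L} {p : Bool} (h : τ s ≠ 0) (h' : (τ + bond u p) s = 0) :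
    τ s = letter p ∧ (s = u ∨ s = u + step L p) := by
  by_cases hs : s = u ∨ s = u + step L p
  · refine ⟨?_, hs⟩
    have := eq_of_add_letter_eq_zero h'
    rwa [bond, if_pos hs] at this
  · exact absurd (by simpa [bond, hs] using h') h

/-- A bond that empties the lowest diagonal truncates the unique lowest site. -/
lemma truncate_bottom {τ : Cfg L} {a : ZMod L} {k : ℕ} {u : Site L} {p : Bool} (hk : k < L)
    (hL : 1 < L)
    (hw : Within τ a k) (ho : Occ τ a) (hn : ¬ Occ (τ + bond u p) a) (ha : Anti τ u p) :
    diagOf u = a ∧ τ u = letter p ∧ (∀ s, diagOf s = a → τ s ≠ 0 → s = u) ∧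
      detect p (τ (u + step L p)) = 1 := by
  have key : ∀ s, diagOf s = a → τ s ≠ 0 → s = u ∧ τ s = letter p := by
    intro s hs hs0
    obtain ⟨h1, h2⟩ := emptied (u := u) (p := p) hs0 (by
      by_contra h; exact hn ⟨s, hs, h⟩)
    refine ⟨?_, h1⟩
    rcases h2 with h2 | h2
    · exact h2
    · exfalso
      rw [h2] at h1 hs
      unfold Anti at ha
      rw [h1, detect_letter, add_zero] at ha
      obtain ⟨m, hm, hm'⟩ := hw u (ne_zero_of_detect ha)
      rw [diagOf_add_step, hm'] at hs
      have : ((m + 1 : ℕ) : ZMod L) = 0 := by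
        push_cast
        linear_combination hs
      rcases Nat.lt_or_ge (m + 1) L with h | h
      · have := cast_inj_of_lt (L := L) h (n := 0) (by omega) (by simpa using this)
        omega
      · omega
  obtain ⟨s, hs, hs0⟩ := ho
  obtain ⟨rfl, h1⟩ := key s hs hs0
  refine ⟨hs, h1, fun t ht ht0 => (key t ht ht0).1, ?_⟩
  unfold Anti at ha
  rwa [h1, detect_letter, zero_add] at ha

/-- A bond that empties the highest diagonal truncates the unique highest site. -/
lemma truncate_top {τ : Cfg L} {a : ZMod L} {k : ℕ} {u : Site L} {p : Bool} (hk : k + 1 < L)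
    (hw : Within τ a (k + 1)) (ho : Occ τ (a + (k : ZMod L)))
    (hn : ¬ Occ (τ + bond u p) (a + (k : ZMod L))) (ha : Anti τ u p) :
    τ (u + step L p) = letter p ∧
      (∀ s, diagOf s = a + (k : ZMod L) → τ s ≠ 0 → s = u + step L p) ∧
      diagOf (u + step L p) = a + (k : ZMod L) ∧ detect p (τ u) = 1 := by
  have key : ∀ s, diagOf s = a + (k : ZMod L) → τ s ≠ 0 →
      s = u + step L p ∧ τ s = letter p := by
    intro s hs hs0
    obtain ⟨h1, h2⟩ := emptied (u := u) (p := p) hs0 (by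
      by_contra h; exact hn ⟨s, hs, h⟩)
    refine ⟨?_, h1⟩
    rcases h2 with h2 | h2
    · exfalso
      rw [h2] at h1 hs
      unfold Anti at ha
      rw [h1, detect_letter, zero_add] at ha
      obtain ⟨m, hm, hm'⟩ := hw _ (ne_zero_of_detect ha)
      rw [diagOf_add_step, hs] at hm'
      have := shift_inj_of_lt (L := L) (a := a) (m := k + 1) (n := m) hk (by omega) (by
        push_cast; rw [← add_assoc]; exact hm')
      omega
    · exact h2
  obtain ⟨s, hs, hs0⟩ := ho
  obtain ⟨rfl, h1⟩ := key s hs hs0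
  refine ⟨h1, fun t ht ht0 => (key t ht ht0).1, hs, ?_⟩
  unfold Anti at ha
  rwa [h1, detect_letter, add_zero] at ha

/-- The staircase letters alternate. -/
def turn (p : Bool) : ℕ → Bool
  | 0 => p
  | j + 1 => !(turn p j)

/-- The staircase that starts at `w` in the direction `step L p`. -/
def stairSite (w : Site L) (p : Bool) : ℕ → Site L
  | 0 => w
  | j + 1 => stairSite w p j + step L (turn p j)

lemma turn_not (p : Bool) (j : ℕ) : turn (!p) j = turn p (j + 1) := by
  induction j with
  | zero => rfl
  | succ j ih => rw [turn, ih]; rfl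

lemma stairSite_add_step (w : Site L) (p : Bool) (j : ℕ) :
    stairSite (w + step L p) (!p) j = stairSite w p (j + 1) := by
  induction j with
  | zero => rfl
  | succ j ih => rw [stairSite, ih, turn_not]; rfl

lemma diagOf_stairSite (w : Site L) (p : Bool) (j : ℕ) :
    diagOf (stairSite w p j) = diagOf w + (j : ZMod L) := by
  induction j with
  | zero => simp [stairSite]
  | succ j ih => rw [stairSite, diagOf_add_step, ih]; push_cast; ring

lemma diagOf_stairSite_add (w : Site L) (p : Bool) (i j : ℕ) :
    diagOf (stairSite w p (i + j)) = diagOf (stairSite w p i) + (j : ZMod L) := by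
  rw [diagOf_stairSite, diagOf_stairSite]; push_cast; ring

lemma stairSite_inj {w : Site L} {p : Bool} {i x y : ℕ} (hx : x < L) (hy : y < L)
    (h : diagOf (stairSite w p (i + x)) = diagOf (stairSite w p (i + y))) : x = y := by
  rw [diagOf_stairSite_add, diagOf_stairSite_add] at h
  exact shift_inj_of_lt hx hy h

/-- The product of `m` consecutive staircase bonds, starting with the `i`-th one. -/
def chain (w : Site L) (p : Bool) (i m : ℕ) : Cfg L :=
  ∑ j ∈ Finset.Ico i (i + m), bond (stairSite w p j) (turn p j)

lemma chain_zero (w : Site L) (p : Bool) (i : ℕ) : chain w p i 0 = 0 := by simp [chain]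

lemma chain_succ (w : Site L) (p : Bool) (i m : ℕ) :
    chain w p i (m + 1) = chain w p i m + bond (stairSite w p (i + m)) (turn p (i + m)) := by
  rw [chain, ← add_assoc, Finset.sum_Ico_succ_top (by omega)]; rfl

lemma chain_succ' (w : Site L) (p : Bool) (i m : ℕ) :
    chain w p i (m + 1) = bond (stairSite w p i) (turn p i) + chain w p (i + 1) m := by
  rw [chain, Finset.sum_eq_sum_Ico_succ_bot (by omega), chain,
    show i + (m + 1) = i + 1 + m by omega]

lemma chain_apply_eq_zero {w : Site L} {p : Bool} {i m : ℕ} {s : Site L}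
    (h : ∀ x ≤ m, s ≠ stairSite w p (i + x)) : chain w p i m s = 0 := by
  rw [chain, Finset.sum_apply]
  refine Finset.sum_eq_zero fun j hj => ?_
  rw [Finset.mem_Ico] at hj
  obtain ⟨x, rfl⟩ := Nat.exists_eq_add_of_le hj.1
  exact bond_apply_eq_zero (h x (by omega)) (h (x + 1) (by omega))

lemma chain_apply {w : Site L} {p : Bool} {i m x : ℕ} (hm : m < L) (hx : x ≤ m) :
    chain w p i m (stairSite w p (i + x)) =
      (if 0 < x then letter (turn p (i + x - 1)) else 0) +
        (if x < m then letter (turn p (i + x)) else 0) := by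
  induction m with
  | zero => simp [chain_zero, show x = 0 by omega]
  | succ m ih =>
    rw [chain_succ, Pi.add_apply]
    rcases Nat.lt_or_ge m x with h | h
    · obtain rfl : x = m + 1 := by omega
      rw [chain_apply_eq_zero, zero_add]
      · rw [← add_assoc, stairSite, bond_apply_right]; simp
      · intro y hy e
        have := stairSite_inj (by omega) (by omega) (congrArg diagOf e)
        omega
    · rw [ih (by omega) h]
      rcases Nat.lt_or_ge x m with h' | h'
      · rw [bond_apply_of_diag, if_pos h', if_pos (show x < m + 1 by omega), add_zero]
        · intro e
          have := stairSite_inj (by omega) (by omega) e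
          omega
        · intro e
          rw [← diagOf_add_step _ (turn p (i + m))] at e
          have := stairSite_inj (x := x) (y := m + 1) (by omega) (by omega) e
          omega
      · obtain rfl : x = m := by omega
        rw [bond_apply_left]; simp

lemma chain_apply_first {w : Site L} {p : Bool} {i m : ℕ} (hm : m + 1 < L) :
    chain w p i (m + 1) (stairSite w p i) = letter (turn p i) := by
  simpa using chain_apply (w := w) (p := p) (i := i) (x := 0) hm (by omega)

lemma chain_apply_last {w : Site L} {p : Bool} {i m : ℕ} (hm : m + 1 < L) :
    chain w p i (m + 1) (stairSite w p (i + m + 1)) = letter (turn p (i + m)) := by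
  simpa [← add_assoc] using chain_apply (w := w) (p := p) (i := i) (x := m + 1) hm le_rfl

lemma chain_apply_mid {w : Site L} {p : Bool} {i m x : ℕ} (hm : m < L) (h0 : 0 < x)
    (hx : x < m) : chain w p i m (stairSite w p (i + x)) = (1, 1) := by
  rw [chain_apply hm hx.le, if_pos h0, if_pos hx]
  obtain ⟨y, rfl⟩ := Nat.exists_eq_succ_of_ne_zero h0.ne'
  exact letter_add_letter_not (turn p (i + y))

lemma chain_apply_ne_zero {w : Site L} {p : Bool} {i m x : ℕ} (hm : m + 1 < L)
    (hx : x ≤ m + 1) : chain w p i (m + 1) (stairSite w p (i + x)) ≠ 0 := by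
  rcases Nat.eq_zero_or_pos x with rfl | h0
  · rw [add_zero, chain_apply_first hm]; exact letter_ne_zero _
  · rcases Nat.lt_or_ge x (m + 1) with h | h
    · rw [chain_apply_mid hm h0 h]; decide
    · obtain rfl : x = m + 1 := by omega
      rw [← add_assoc, chain_apply_last hm]; exact letter_ne_zero _

lemma chain_within {w : Site L} {p : Bool} {i m : ℕ} :
    Within (chain w p i m) (diagOf (stairSite w p i)) (m + 1) := by
  intro s hs
  by_contra hc
  refine hs (chain_apply_eq_zero fun x hx e => hc ⟨x, by omega, ?_⟩)
  rw [e, diagOf_stairSite_add]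

end Lattice

section Dynamics

variable {L : ℕ}

open Classical in
/-- The contribution of the bond `β` to the coefficient of `τ` in the commutator. -/
noncomputable def term (J : Bool → ℂ) (r : Cfg L → ℂ) (τ : Cfg L) (β : Site L × Bool) : ℂ :=
  if Anti τ β.1 β.2 then J β.2 * r (τ + bond β.1 β.2) else 0

/-- The coefficients `r` describe a conserved quantity made of products that fit into `k`
consecutive diagonals. -/
structure Conserved (L : ℕ) [NeZero L] (k : ℕ) (J : Bool → ℂ) (r : Cfg L → ℂ) : Prop where
  coupling : ∀ p, J p ≠ 0
  eqn : ∀ τ, ∑ β, term J r τ β = 0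
  within : ∀ τ, r τ ≠ 0 → ∃ a, Within τ a k

variable {J : Bool → ℂ} {r : Cfg L → ℂ}

lemma term_ne_zero {τ : Cfg L} {β : Site L × Bool} (h : term J r τ β ≠ 0) :
    Anti τ β.1 β.2 ∧ r (τ + bond β.1 β.2) ≠ 0 := by
  unfold term at h
  split at h
  · exact ⟨by assumption, right_ne_zero_of_mul h⟩
  · exact absurd rfl h

lemma term_of_anti {τ : Cfg L} {u : Site L} {p : Bool} (h : Anti τ u p) :
    term J r τ (u, p) = J p * r (τ + bond u p) := if_pos h

variable {n : ℕ}

/-- The data of a product of maximal length with a bond attached to its highest site. -/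
structure Extension (n : ℕ) (r : Cfg L → ℂ) (A : Cfg L) (a : ZMod L) (u : Site L) (p : Bool) :
    Prop where
  coeff : r A ≠ 0
  bottom : Occ A a
  top : diagOf u = a + ((n + 1 : ℕ) : ZMod L)
  detects : detect p (A u) = 1

lemma Extension.occ_top {A : Cfg L} {a : ZMod L} {u : Site L} {p : Bool}
    (hE : Extension n r A a u p) : Occ A (a + ((n + 1 : ℕ) : ZMod L)) :=
  ⟨u, hE.top, ne_zero_of_detect hE.detects⟩

lemma exists_extension {A : Cfg L} {a : ZMod L} (h : r A ≠ 0) (h1 : Occ A a)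
    (h2 : Occ A (a + ((n + 1 : ℕ) : ZMod L))) : ∃ u p, Extension n r A a u p := by
  obtain ⟨u, hu, hu0⟩ := h2
  obtain ⟨p, hp⟩ := exists_detect hu0
  exact ⟨u, p, h, h1, hu, hp⟩

lemma add_bond_apply_of_lt {A : Cfg L} {a : ZMod L} {u s : Site L} {p : Bool} {i j : ℕ}
    (hu : diagOf u = a + (j : ZMod L)) (hs : diagOf s = a + (i : ZMod L))
    (hj : j + 1 < L) (hi : i < L) (h : i ≠ j) (h' : i ≠ j + 1) : (A + bond u p) s = A s := by
  rw [Pi.add_apply, bond_apply_of_diag, add_zero]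
  · rw [hu, hs]; exact fun e => h (shift_inj_of_lt hi (by omega) e)
  · rw [hu, hs, add_assoc]
    exact fun e => h' (shift_inj_of_lt hi hj (by push_cast; exact e))

variable [NeZero L]

lemma Conserved.exists_other {k : ℕ} (hC : Conserved L k J r) {τ : Cfg L} {β : Site L × Bool}
    (h : term J r τ β ≠ 0) : ∃ γ ≠ β, term J r τ γ ≠ 0 := by
  by_contra! hc
  refine h ?_
  rw [← hC.eqn τ, Finset.sum_eq_single β (fun γ _ hγ => hc γ hγ) (by simp)]

lemma Conserved.not_occ {k : ℕ} (hC : Conserved L k J r) (hkL : 2 * k ≤ L)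
    {τ : Cfg L} (h : r τ ≠ 0) (a : ZMod L) (h1 : Occ τ a) : ¬ Occ τ (a + (k : ZMod L)) := by
  rintro ⟨v, hv, hv0⟩
  obtain ⟨u, hu, hu0⟩ := h1
  obtain ⟨c, hc⟩ := hC.within τ h
  obtain ⟨m, hm, hm'⟩ := hc u hu0
  obtain ⟨n, hn, hn'⟩ := hc v hv0
  have := shift_inj_of_lt (L := L) (a := c) (m := m + k) (n := n) (by omega) (by omega) (by
    rw [← hn', hv, ← hu, hm']; push_cast; ring)
  omega

/-- A product that reaches both end diagonals lies between them. -/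
lemma Conserved.within_of_occ (hC : Conserved L (n + 2) J r) (hkL : 2 * (n + 2) ≤ L)
    {τ : Cfg L} (h : r τ ≠ 0) {a : ZMod L} (h1 : Occ τ a)
    (h2 : Occ τ (a + ((n + 1 : ℕ) : ZMod L))) : Within τ a (n + 2) := by
  obtain ⟨v, hv, hv0⟩ := h2
  obtain ⟨u, hu, hu0⟩ := h1
  obtain ⟨c, hc⟩ := hC.within τ h
  obtain ⟨m, hm, hm'⟩ := hc u hu0
  obtain ⟨m₂, hm₂, hm₂'⟩ := hc v hv0
  have := shift_inj_of_lt (L := L) (a := c) (m := m + (n + 1)) (n := m₂) (by omega) (by omega) (by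
    rw [← hm₂', hv, ← hu, hm']; push_cast; ring)
  obtain rfl : m = 0 := by omega
  have : a = c := by rw [← hu, hm']; simp
  rwa [this]

/-- Shiraishi shift: the appended product can be truncated at a unique lowest site. -/
lemma Conserved.shift (hC : Conserved L (n + 2) J r) (hkL : 2 * (n + 2) ≤ L) {A : Cfg L}
    {a : ZMod L} {u : Site L} {p : Bool} (hE : Extension n r A a u p) :
    Within (A + bond u p) a (n + 3) ∧
    (∀ s, diagOf s = a + ((n + 2 : ℕ) : ZMod L) → (A + bond u p) s ≠ 0 → s = u + step L p) ∧
    (A + bond u p) (u + step L p) = letter p ∧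
    ∃ w p', diagOf w = a ∧ (A + bond u p) w = letter p' ∧
      (∀ s, diagOf s = a → (A + bond u p) s ≠ 0 → s = w) ∧
      detect p' ((A + bond u p) (w + step L p')) = 1 ∧
      r (A + bond u p + bond w p') ≠ 0 := by
  have hw := hC.within_of_occ hkL hE.coeff hE.bottom hE.occ_top
  have htop : diagOf (u + step L p) = a + ((n + 2 : ℕ) : ZMod L) := by
    rw [diagOf_add_step, hE.top]; push_cast; ring
  have hA0 : ∀ s, diagOf s = a + ((n + 2 : ℕ) : ZMod L) → A s = 0 := by
    intro s hs
    by_contra h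
    obtain ⟨m, hm, hm'⟩ := hw s h
    have := shift_inj_of_lt (L := L) (by omega) (by omega) (hs.symm.trans hm')
    omega
  set τ := A + bond u p with hτ
  have hτtop : τ (u + step L p) = letter p := by
    rw [hτ, Pi.add_apply, hA0 _ htop, bond_apply_right, zero_add]
  have hτu : ∀ s, diagOf s = a + ((n + 2 : ℕ) : ZMod L) → τ s ≠ 0 → s = u + step L p := by
    intro s hs hs0
    by_contra h
    refine hs0 ?_
    rw [hτ, Pi.add_apply, hA0 _ hs, bond_apply_eq_zero _ h, zero_add]
    rintro rfl
    have := shift_inj_of_lt (L := L) (by omega) (by omega) (hs.symm.trans hE.top)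
    omega
  have hwτ : Within τ a (n + 3) := by
    intro s hs
    by_cases h : A s = 0
    · have h' : bond u p s ≠ 0 := by simpa [hτ, h] using hs
      by_cases h1 : s = u
      · exact ⟨n + 1, by omega, h1 ▸ hE.top⟩
      · by_cases h2 : s = u + step L p
        · exact ⟨n + 2, by omega, h2 ▸ htop⟩
        · exact absurd (bond_apply_eq_zero h1 h2) h'
    · obtain ⟨m, hm, hm'⟩ := hw s h
      exact ⟨m, by omega, hm'⟩
  have hanti : Anti τ u p := by
    unfold Anti
    rw [hτtop, detect_letter, add_zero, hτ, detect_add_bond, hE.detects]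
  have hocc : Occ τ a := by
    obtain ⟨s, hs, hs0⟩ := hE.bottom
    refine ⟨s, hs, ?_⟩
    rwa [hτ, add_bond_apply_of_lt (i := 0) hE.top (by simpa using hs) (by omega) (by omega)
      (by omega) (by omega)]
  have hocc' : Occ τ (a + ((n + 2 : ℕ) : ZMod L)) :=
    ⟨_, htop, by rw [hτtop]; exact letter_ne_zero p⟩
  refine ⟨hwτ, hτu, hτtop, ?_⟩
  have hterm : term J r τ (u, p) ≠ 0 := by
    rw [term_of_anti hanti, hτ, add_bond_self]
    exact mul_ne_zero (hC.coupling p) hE.coeff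
  obtain ⟨⟨w, p'⟩, hne, hγ⟩ := hC.exists_other hterm
  obtain ⟨hanti', hr'⟩ := term_ne_zero hγ
  by_cases ho : Occ (τ + bond w p') a
  · exfalso
    have hn := hC.not_occ hkL hr' a ho
    obtain ⟨h1, h2, -, -⟩ := truncate_top (k := n + 2) (by omega) hwτ hocc' hn hanti'
    have h3 := h2 _ htop (by rw [hτtop]; exact letter_ne_zero p)
    rw [← h3, hτtop] at h1
    obtain rfl := letter_injective h1
    exact hne (by rw [add_right_cancel h3])
  · obtain ⟨h1, h2, h3, h4⟩ := truncate_bottom (k := n + 3) (by omega) (by omega) hwτ hocc ho hanti'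
    exact ⟨w, p', h1, h2, h3, h4, hr'⟩

/-- Every diagonal carries at most one site. -/
lemma Conserved.unique_site (hC : Conserved L (n + 2) J r) (hkL : 2 * (n + 2) ≤ L) {j : ℕ} :
    ∀ {A : Cfg L} {a : ZMod L}, j < n + 2 → r A ≠ 0 → Occ A a →
      Occ A (a + ((n + 1 : ℕ) : ZMod L)) → ∀ s t, diagOf s = a + (j : ZMod L) →
      diagOf t = a + (j : ZMod L) → A s ≠ 0 → A t ≠ 0 → s = t := by
  induction j with
  | zero =>
    intro A a _ h h1 h2 s t hs ht hs0 ht0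
    obtain ⟨u, p, hE⟩ := exists_extension h h1 h2
    obtain ⟨-, -, -, w, p', -, -, hu, -⟩ := hC.shift hkL hE
    have hval : ∀ x, diagOf x = a + ((0 : ℕ) : ZMod L) → A x ≠ 0 → x = w := by
      intro x hx hx0
      refine hu x (by simpa using hx) ?_
      rwa [add_bond_apply_of_lt hE.top hx (by omega) (by omega) (by omega) (by omega)]
    rw [hval s hs hs0, hval t ht ht0]
  | succ j ih =>
    intro A a hj h h1 h2 s t hs ht hs0 ht0
    obtain ⟨u, p, hE⟩ := exists_extension h h1 h2
    obtain ⟨-, -, htop, w, p', hw, -, -, hd, hr⟩ := hC.shift hkL hE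
    have hw' : diagOf w = a + ((0 : ℕ) : ZMod L) := by simpa using hw
    have hval : ∀ x, diagOf x = a + ((j + 1 : ℕ) : ZMod L) → A x ≠ 0 →
        (A + bond u p + bond w p') x ≠ 0 := by
      intro x hx hx0
      have hτ : (A + bond u p) x ≠ 0 := by
        by_cases hxu : x = u
        · rw [hxu]
          refine ne_zero_of_detect (p := p) ?_
          rw [detect_add_bond, hE.detects]
        · rw [Pi.add_apply, bond_apply_eq_zero hxu, add_zero]
          · exact hx0
          · rintro rfl
            rw [diagOf_add_step, hE.top, add_assoc] at hx
            have := shift_inj_of_lt (L := L) (a := a) (m := n + 2) (n := j + 1) (by omega) (by omega)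
              (by rw [← hx]; push_cast; ring)
            omega
      by_cases hxw : x = w + step L p'
      · rw [hxw]
        refine ne_zero_of_detect (p := p') ?_
        rw [detect_add_bond, hd]
      · rw [Pi.add_apply, bond_apply_eq_zero _ hxw, add_zero]
        · exact hτ
        · rintro rfl
          have := shift_inj_of_lt (L := L) (by omega) (by omega) (hx.symm.trans hw')
          omega
    refine ih (A := A + bond u p + bond w p') (a := a + 1) (by omega) hr ?_ ?_ s t ?_ ?_
      (hval s hs hs0) (hval t ht ht0)
    · refine ⟨w + step L p', by rw [diagOf_add_step, hw], ne_zero_of_detect (p := p') ?_⟩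
      rw [detect_add_bond, hd]
    · have hd' : diagOf (u + step L p) = a + ((n + 2 : ℕ) : ZMod L) := by
        rw [diagOf_add_step, hE.top]; push_cast; ring
      refine ⟨u + step L p, by rw [hd']; push_cast; ring, ?_⟩
      rw [add_bond_apply_of_lt hw' hd' (by omega) (by omega) (by omega) (by omega), htop]
      exact letter_ne_zero p
    · rw [hs]; push_cast; ring
    · rw [ht]; push_cast; ring

/-- The shifted product, extended by the other letter. -/
lemma Conserved.next_extension (hC : Conserved L (n + 2) J r) (hkL : 2 * (n + 2) ≤ L)
    {A : Cfg L} {a : ZMod L} {u : Site L} {p : Bool} (hE : Extension n r A a u p)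
    {w : Site L} {p' : Bool} (hw : diagOf w = a) (hwτ : (A + bond u p) w = letter p') :
    Extension n r (A + bond u p + bond w p') (a + 1) (u + step L p) (!p) ∧
      detect p' ((A + bond u p) (w + step L p')) = 1 := by
  obtain ⟨-, -, htop, w₀, p₀, hw₀, hl, hu, hd, hr⟩ := hC.shift hkL hE
  obtain rfl := hu w hw (by rw [hwτ]; exact letter_ne_zero p')
  obtain rfl := letter_injective (hl.symm.trans hwτ)
  refine ⟨⟨hr, ?_, ?_, ?_⟩, hd⟩
  · refine ⟨w + step L p₀, by rw [diagOf_add_step, hw], ne_zero_of_detect (p := p₀) ?_⟩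
    rw [detect_add_bond, hd]
  · rw [diagOf_add_step, hE.top]; ring
  · rw [add_bond_apply_of_lt (a := a) (i := n + 2) (j := 0) (by simpa using hw) (by
      rw [diagOf_add_step, hE.top]; push_cast; ring) (by omega) (by omega) (by omega) (by omega),
      htop, detect_letter_not]

/-- The interior of an extended product follows the staircase and consists of `Z`. -/
lemma Conserved.interior (hC : Conserved L (n + 2) J r) (hkL : 2 * (n + 2) ≤ L) {j : ℕ} :
    ∀ {A : Cfg L} {a : ZMod L} {u : Site L} {p : Bool} {w : Site L} {p' : Bool},
      Extension n r A a u p → diagOf w = a → (A + bond u p) w = letter p' → j < n + 1 →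
      (A + bond u p) (stairSite w p' (j + 1)) = (1, 1) ∧
      ∃ B : Cfg L, B = A + bond u p + bond w p' ∧
        Extension n r B (a + 1) (u + step L p) (!p) ∧
        (B + bond (u + step L p) (!p)) (w + step L p') = letter (!p') := by
  induction j with
  | zero =>
    intro A a u p w p' hE hw hl _
    obtain ⟨hE', hd⟩ := hC.next_extension hkL hE hw hl
    obtain ⟨-, -, -, w₁, p₁, hw₁, hl₁, hu₁, hd₁, hr₁⟩ := hC.shift hkL hE'
    have hdw : diagOf (w + step L p') = a + 1 := by rw [diagOf_add_step, hw]
    have heq : (A + bond u p + bond w p' + bond (u + step L p) (!p)) (w + step L p') =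
        (A + bond u p + bond w p') (w + step L p') :=
      add_bond_apply_of_lt (i := 0) hE'.top (by simpa using hdw) (by omega) (by omega)
        (by omega) (by omega)
    have hd' : detect p' ((A + bond u p + bond w p') (w + step L p')) = 1 := by
      rw [detect_add_bond, hd]
    obtain rfl := hu₁ _ hdw (by rw [heq]; exact ne_zero_of_detect hd')
    obtain rfl : p₁ = !p' := by
      rw [← heq, hl₁] at hd'
      exact eq_not_of_detect_letter hd'
    refine ⟨?_, _, rfl, hE', hl₁⟩
    rw [← add_bond_self (A + bond u p) w p', Pi.add_apply, stairSite, stairSite, turn, ← heq, hl₁,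
      bond_apply_right, add_comm, letter_add_letter_not]
  | succ j ih =>
    intro A a u p w p' hE hw hl hj
    obtain ⟨-, B, rfl, hE', hl'⟩ := ih hE hw hl (by omega)
    refine ⟨?_, _, rfl, hE', hl'⟩
    have hdw : diagOf (w + step L p') = a + 1 := by rw [diagOf_add_step, hw]
    obtain ⟨h1, -⟩ := ih hE' hdw hl' (by omega)
    rw [stairSite_add_step, add_bond_apply_of_lt (a := a) (j := n + 2) (i := j + 2),
      add_bond_apply_of_lt (a := a) (j := 0) (i := j + 2)] at h1
    · exact h1
    · simpa using hw
    · rw [diagOf_stairSite, hw]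
    · omega
    · omega
    · omega
    · omega
    · rw [hE'.top]; push_cast; ring
    · rw [diagOf_stairSite, hw]
    · omega
    · omega
    · omega
    · omega

/-- Products of maximal length are chains of staircase bonds. -/
lemma Conserved.eq_chain (hC : Conserved L (n + 2) J r) (hkL : 2 * (n + 2) ≤ L) {A : Cfg L}
    {a : ZMod L} (h : r A ≠ 0) (h1 : Occ A a) (h2 : Occ A (a + ((n + 1 : ℕ) : ZMod L))) :
    ∃ w p, diagOf w = a ∧ A = chain w p 0 (n + 1) := by
  obtain ⟨u, p, hE⟩ := exists_extension h h1 h2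
  obtain ⟨-, hutop, htop, w, p', hw, hl, -⟩ := hC.shift hkL hE
  have hint : ∀ j < n + 1, (A + bond u p) (stairSite w p' (j + 1)) = (1, 1) :=
    fun j hj => (hC.interior hkL hE hw hl hj).1
  obtain ⟨-, B, hB, hE', hl'⟩ := hC.interior (j := 0) hkL hE hw hl (by omega)
  have hdw : diagOf (w + step L p') = a + 1 := by rw [diagOf_add_step, hw]
  have hds : ∀ j : ℕ, diagOf (stairSite w p' j) = a + (j : ZMod L) := by
    intro j; rw [diagOf_stairSite, hw]
  have hw' : diagOf w = a + ((0 : ℕ) : ZMod L) := by simpa using hw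
  have hnext := (hC.interior (j := n) hkL hE' hdw hl' (by omega)).1
  rw [stairSite_add_step] at hnext
  have hlast : stairSite w p' (n + 2) = u + step L p := by
    by_contra hne
    refine hne (hutop _ (hds _) ?_)
    rw [Pi.add_apply, bond_apply_eq_zero hne, add_zero, hB,
      add_bond_apply_of_lt hw' (hds _) (by omega) (by omega) (by omega) (by omega)] at hnext
    · rw [hnext]; decide
    · intro e
      have := (hds (n + 2)).symm.trans ((congrArg diagOf e).trans
        ((diagOf_add_step _ _).trans (congrArg (· + 1) hE'.top)))
      have := shift_inj_of_lt (L := L) (a := a) (m := n + 2) (n := n + 3) (by omega) (by omega) (by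
        rw [this]; push_cast; ring)
      omega
  have hprev : stairSite w p' (n + 1) = u := by
    by_contra hne
    refine hne (hC.unique_site hkL (j := n + 1) (by omega) h h1 h2 _ _ (hds _) hE.top ?_
      (ne_zero_of_detect hE.detects))
    have := hint n (by omega)
    rw [Pi.add_apply, bond_apply_eq_zero hne, add_zero] at this
    · rw [this]; decide
    · rw [← hlast]
      intro e
      have := stairSite_inj (i := 0) (x := n + 1) (y := n + 2) (L := L) (by omega) (by omega)
        (by simpa using congrArg diagOf e)
      omega
  have hp : turn p' (n + 1) = p := by
    rw [stairSite, hprev] at hlast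
    exact step_injective (by omega) (add_left_cancel hlast)
  have hAτ : A = A + bond u p + bond u p := (add_bond_self A u p).symm
  have hval : ∀ x ≤ n + 1, A (stairSite w p' x) = chain w p' 0 (n + 1) (stairSite w p' x) := by
    intro x hx
    rcases Nat.eq_zero_or_pos x with rfl | h0
    · rw [chain_apply_first (by omega), ← add_bond_apply_of_lt (A := A) (p := p) hE.top (hds 0) (by omega)
        (by omega) (by omega) (by omega)]
      exact hl
    · obtain ⟨y, rfl⟩ := Nat.exists_eq_succ_of_ne_zero h0.ne'
      rcases Nat.lt_or_ge y n with hy | hy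
      · have := chain_apply_mid (w := w) (p := p') (i := 0) (m := n + 1) (x := y + 1) (L := L)
          (by omega) (by omega) (by omega)
        rw [zero_add] at this
        rw [this, ← hint y (by omega), add_bond_apply_of_lt hE.top (hds _) (by omega)
          (by omega) (by omega) (by omega)]
      · obtain rfl : y = n := by omega
        have := chain_apply_last (w := w) (p := p') (i := 0) (m := y) (L := L) (by omega)
        rw [zero_add] at this
        rw [this, hAτ, Pi.add_apply, hint y (by omega), hprev, bond_apply_left, ← hp, turn,
          ← letter_add_letter_not, add_assoc, letter_add_self, add_zero]
  refine ⟨w, p', hw, funext fun s => ?_⟩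
  by_cases hs : ∃ x ≤ n + 1, s = stairSite w p' x
  · obtain ⟨x, hx, rfl⟩ := hs
    exact hval x hx
  · push Not at hs
    rw [chain_apply_eq_zero (by simpa using hs)]
    by_contra hA
    obtain ⟨x, hx, hx'⟩ := hC.within_of_occ hkL h h1 h2 s hA
    refine hs x (by omega) (hC.unique_site hkL hx h h1 h2 _ _ hx' (hds x) hA ?_)
    rw [hval x (by omega)]
    simpa using chain_apply_ne_zero (w := w) (p := p') (i := 0) (m := n) (x := x) (L := L)
      (by omega) (by omega)

end Dynamics

section Relations

variable {L : ℕ} [NeZero L] {J : Bool → ℂ} {r : Cfg L → ℂ} {n : ℕ}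

/-- The `j`-th bond of a staircase. -/
def stairBond (w : Site L) (p : Bool) (j : ℕ) : Site L × Bool := (stairSite w p j, turn p j)

lemma Conserved.sum_eq_zero {k : ℕ} (hC : Conserved L k J r) {τ : Cfg L}
    (S : Finset (Site L × Bool)) (h : ∀ γ, term J r τ γ ≠ 0 → γ ∈ S) :
    ∑ β ∈ S, term J r τ β = 0 := by
  rw [← hC.eqn τ]
  exact Finset.sum_subset (Finset.subset_univ S) fun γ _ hγ => by
    by_contra hne; exact hγ (h γ hne)

omit [NeZero L] in
lemma stairBond_ne {w : Site L} {p : Bool} {i x y : ℕ} (hx : x < L) (hy : y < L) (h : x ≠ y) :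
    stairBond w p (i + x) ≠ stairBond w p (i + y) := fun e =>
  h (stairSite_inj hx hy (congrArg diagOf (congrArg Prod.fst e)))

/-- Consecutive chains on a staircase have proportional coefficients. -/
lemma Conserved.chain_shift (hC : Conserved L (n + 2) J r) (hkL : 2 * (n + 2) ≤ L) (w : Site L)
    (p : Bool) (i : ℕ) :
    J (turn p i) * r (chain w p (i + 1) (n + 1)) +
      J (turn p (i + n + 1)) * r (chain w p i (n + 1)) = 0 := by
  set τ := chain w p i (n + 2) with hτ
  set a := diagOf (stairSite w p i) with ha
  have hfirst : τ (stairSite w p i) = letter (turn p i) := chain_apply_first (by omega)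
  have hlast : τ (stairSite w p (i + n + 2)) = letter (turn p (i + n + 1)) :=
    chain_apply_last (m := n + 1) (by omega)
  have hmid : ∀ x, 0 < x → x < n + 2 → τ (stairSite w p (i + x)) = (1, 1) :=
    fun x h0 hx => chain_apply_mid (by omega) h0 hx
  have hdlast : diagOf (stairSite w p (i + n + 2)) = a + ((n + 2 : ℕ) : ZMod L) :=
    diagOf_stairSite_add w p i (n + 2)
  have hw : Within τ a (n + 3) := chain_within
  have hS := hC.sum_eq_zero (τ := τ) {stairBond w p i, stairBond w p (i + n + 1)} (by
    rintro ⟨g, q⟩ hγ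
    obtain ⟨hanti, hr⟩ := term_ne_zero hγ
    rw [Finset.mem_insert, Finset.mem_singleton]
    by_cases ho : Occ (τ + bond g q) a
    · have hn := hC.not_occ hkL hr a ho
      obtain ⟨h1, h2, -, -⟩ := truncate_top (k := n + 2) (by omega) hw
        ⟨_, hdlast, by rw [hlast]; exact letter_ne_zero _⟩ hn hanti
      have h3 := h2 _ hdlast (by rw [hlast]; exact letter_ne_zero _)
      dsimp only at h1 h3
      rw [← h3, hlast] at h1
      obtain rfl := letter_injective h1
      right
      exact Prod.ext (add_right_cancel h3).symm rfl
    · obtain ⟨-, h2, h3, -⟩ := truncate_bottom (k := n + 3) (by omega) (by omega) hw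
        ⟨_, rfl, by rw [hfirst]; exact letter_ne_zero _⟩ ho hanti
      have h4 := h3 _ rfl (by rw [hfirst]; exact letter_ne_zero _)
      rw [← h4, hfirst] at h2
      left
      exact Prod.ext h4.symm (letter_injective h2).symm)
  have hne : stairBond w p i ≠ stairBond w p (i + n + 1) :=
    stairBond_ne (i := i) (x := 0) (y := n + 1) (by omega) (by omega) (by omega)
  rw [Finset.sum_pair hne, stairBond, stairBond, term_of_anti, term_of_anti] at hS
  · have e1 : τ + bond (stairSite w p i) (turn p i) = chain w p (i + 1) (n + 1) := by
      rw [hτ, chain_succ', add_comm (bond _ _), add_bond_self]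
    have e2 : τ + bond (stairSite w p (i + n + 1)) (turn p (i + n + 1)) =
        chain w p i (n + 1) := by
      rw [hτ, chain_succ]; exact add_bond_self _ _ _
    rwa [e1, e2] at hS
  · have : τ (stairSite w p (i + n + 1)) = (1, 1) := hmid (n + 1) (by omega) (by omega)
    unfold Anti
    rw [this, detect_both]
    change 1 + detect _ (τ (stairSite w p (i + n + 2))) = 1
    rw [hlast, detect_letter, add_zero]
  · have : τ (stairSite w p (i + 1)) = (1, 1) := hmid 1 (by omega) (by omega)
    unfold Anti
    rw [hfirst, detect_letter, zero_add]
    change detect _ (τ (stairSite w p (i + 1))) = 1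
    rw [this, detect_both]

/-- A site next to the staircase, below its site with index `m + 1`. -/
def sideSite (w : Site L) (p : Bool) (m : ℕ) : Site L :=
  stairSite w p (m + 1) - step L (turn p (m + 1))

/-- A bond that sticks out of the staircase. -/
def sideBond (w : Site L) (p : Bool) (m : ℕ) : Cfg L := bond (sideSite w p m) (turn p (m + 1))

omit [NeZero L] in
lemma sideSite_add_step (w : Site L) (p : Bool) (m : ℕ) :
    sideSite w p m + step L (turn p (m + 1)) = stairSite w p (m + 1) := sub_add_cancel _ _

omit [NeZero L] in
lemma diagOf_sideSite (w : Site L) (p : Bool) (m : ℕ) :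
    diagOf (sideSite w p m) = diagOf (stairSite w p m) := by
  have h := diagOf_add_step (sideSite w p m) (turn p (m + 1))
  rw [sideSite_add_step, stairSite, diagOf_add_step] at h
  exact (add_right_cancel h).symm

omit [NeZero L] in
lemma sideSite_ne (hL : 1 < L) (w : Site L) (p : Bool) {i x y : ℕ} (hx : x < L) (hy : y < L) :
    sideSite w p (i + x) ≠ stairSite w p (i + y) := by
  intro h
  have h' := congrArg diagOf h
  rw [diagOf_sideSite] at h'
  obtain rfl := stairSite_inj hx hy h'
  have h2 := sideSite_add_step w p (i + x)
  rw [h, stairSite] at h2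
  have := step_injective hL (add_left_cancel h2)
  simp [turn] at this

/-- The values of a chain with a bond that sticks out. -/
structure TeeValues (n : ℕ) (w : Site L) (p : Bool) (i x : ℕ) (τ : Cfg L) : Prop where
  side : τ (sideSite w p (i + x)) = letter (turn p (i + x + 1))
  foot : τ (stairSite w p (i + x + 1)) =
    letter (turn p (i + x)) + if x < n then 0 else letter (turn p (i + x + 1))
  other : ∀ y ≤ n + 1, y ≠ x + 1 →
    τ (stairSite w p (i + y)) = chain w p i (n + 1) (stairSite w p (i + y))
  supp : ∀ s, τ s ≠ 0 → s = sideSite w p (i + x) ∨ ∃ y ≤ n + 1, s = stairSite w p (i + y)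

omit [NeZero L] in
lemma teeValues (hL : n + 2 < L) (w : Site L) (p : Bool) {i x : ℕ} (hx : x ≤ n) :
    TeeValues n w p i x (chain w p i (n + 1) + sideBond w p (i + x)) where
  side := by
    rw [Pi.add_apply, sideBond, bond_apply_left, chain_apply_eq_zero, zero_add]
    exact fun y hy => sideSite_ne (by omega) w p (by omega) (by omega)
  foot := by
    have h := chain_apply (w := w) (p := p) (i := i) (m := n + 1) (x := x + 1) (L := L)
      (by omega) (by omega)
    rw [if_pos (by omega)] at h
    rw [Pi.add_apply, sideBond]
    nth_rw 2 [← sideSite_add_step]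
    rw [bond_apply_right]
    change chain w p i (n + 1) (stairSite w p (i + (x + 1))) + _ = _
    rw [h, add_assoc, show i + (x + 1) - 1 = i + x by omega]
    congr 1
    by_cases hxn : x < n
    · rw [if_pos hxn, if_pos (by omega)]; exact letter_add_self _
    · rw [if_neg hxn, if_neg (by omega), zero_add]
  other := by
    intro y hy hyx
    rw [Pi.add_apply, sideBond, bond_apply_eq_zero, add_zero]
    · exact (sideSite_ne (by omega) w p (by omega) (by omega)).symm
    · rw [sideSite_add_step]
      intro e
      exact hyx (stairSite_inj (i := i) (by omega) (by omega) (congrArg diagOf e))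
  supp := by
    intro s hs
    by_contra hc
    push Not at hc
    refine hs ?_
    rw [Pi.add_apply, chain_apply_eq_zero hc.2, sideBond, bond_apply_eq_zero hc.1, add_zero]
    rw [sideSite_add_step]
    exact hc.2 (x + 1) (by omega)

/-- Only three bonds contribute to the coefficient of a chain with a bond that sticks out. -/
lemma Conserved.tee_mem (hC : Conserved L (n + 2) J r) (hkL : 2 * (n + 2) ≤ L) {w : Site L}
    {p : Bool} {i x : ℕ} (hx : x ≤ n) {γ : Site L × Bool}
    (hγ : term J r (chain w p i (n + 1) + sideBond w p (i + x)) γ ≠ 0) :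
    γ = stairBond w p i ∨ γ = stairBond w p (i + n) ∨
      γ = (sideSite w p (i + x), turn p (i + x + 1)) := by
  have hT := teeValues (L := L) (n := n) (i := i) (by omega) w p hx
  set τ := chain w p i (n + 1) + sideBond w p (i + x) with hτ
  obtain ⟨g, q⟩ := γ
  obtain ⟨hanti, hr⟩ := term_ne_zero hγ
  dsimp only at hanti hr
  set a := diagOf (stairSite w p i) with ha
  have hd : ∀ y, diagOf (stairSite w p (i + y)) = a + (y : ZMod L) :=
    diagOf_stairSite_add w p i
  have hdx : diagOf (sideSite w p (i + x)) = a + (x : ZMod L) := by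
    rw [diagOf_sideSite, hd]
  have hw : Within τ a (n + 2) := by
    intro s hs
    rcases hT.supp s hs with rfl | ⟨y, hy, rfl⟩
    · exact ⟨x, by omega, hdx⟩
    · exact ⟨y, by omega, hd y⟩
  have hfirst : τ (stairSite w p i) = letter (turn p i) := by
    have := hT.other 0 (by omega) (by omega)
    rw [add_zero, chain_apply_first (by omega)] at this
    exact this
  have hlast : x < n → τ (stairSite w p (i + (n + 1))) = letter (turn p (i + n)) := by
    intro h
    rw [hT.other (n + 1) le_rfl (by omega)]
    exact chain_apply_last (by omega)
  have hlast' : x = n → τ (stairSite w p (i + (n + 1))) = (1, 1) := by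
    rintro rfl
    have := hT.foot
    rw [if_neg (lt_irrefl _)] at this
    exact this.trans (letter_add_letter_not _)
  have hlast0 : τ (stairSite w p (i + (n + 1))) ≠ 0 := by
    rcases Nat.lt_or_ge x n with h | h
    · rw [hlast h]; exact letter_ne_zero _
    · rw [hlast' (by omega)]; decide
  by_cases ho : Occ (τ + bond g q) a
  · by_cases ho' : Occ (τ + bond g q) (a + ((n + 1 : ℕ) : ZMod L))
    · have huniq := hC.unique_site hkL (j := x) (by omega) hr ho ho' _ _ hdx (hd x)
      have hne := sideSite_ne (L := L) (by omega) w p (i := i) (x := x) (y := x)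
        (by omega) (by omega)
      have hprev : ∀ s, τ s ≠ 0 → diagOf s + 1 = a + (x : ZMod L) →
          ∃ y, y + 1 = x ∧ s = stairSite w p (i + y) := by
        intro s hs hds
        rcases hT.supp s hs with rfl | ⟨y, hy, rfl⟩
        · rw [hdx] at hds
          exact absurd (by simpa using hds) (one_ne_zero_of_lt (L := L) (by omega))
        · refine ⟨y, ?_, rfl⟩
          rw [hd] at hds
          exact shift_inj_of_lt (L := L) (a := a) (by omega) (by omega) (by
            rw [← hds]; push_cast; ring)
      by_cases hs : (τ + bond g q) (sideSite w p (i + x)) = 0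
      · obtain ⟨h1, h2⟩ := emptied (by rw [hT.side]; exact letter_ne_zero _) hs
        have hq := letter_injective (hT.side.symm.trans h1)
        rcases h2 with h2 | h2
        · exact Or.inr (Or.inr (Prod.ext h2.symm hq.symm))
        · exfalso
          unfold Anti at hanti
          rw [← h2, h1, detect_letter, add_zero] at hanti
          obtain ⟨y, rfl, hy⟩ := hprev g (ne_zero_of_detect hanti) (by
            rw [← diagOf_add_step g q, ← h2, hdx])
          refine hne ?_
          rw [h2, hy, ← hq, show turn p (i + (y + 1) + 1) = turn p (i + y) from Bool.not_not _]
          rfl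
      · have hs' : (τ + bond g q) (stairSite w p (i + x)) = 0 := by
          by_contra h
          exact hne (huniq hs h)
        have hval := hT.other x (by omega) (by omega)
        obtain ⟨h1, h2⟩ := emptied (by
          rw [hval]; exact chain_apply_ne_zero (by omega) (by omega)) hs'
        rcases Nat.eq_zero_or_pos x with rfl | h0
        · have hq := letter_injective (hfirst.symm.trans h1)
          rcases h2 with h2 | h2
          · exact Or.inl (Prod.ext h2.symm hq.symm)
          · exfalso
            unfold Anti at hanti
            rw [← h2, h1, detect_letter, add_zero] at hanti
            obtain ⟨y, hy, -⟩ := hprev g (ne_zero_of_detect hanti) (by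
              rw [← diagOf_add_step g q, ← h2, hd])
            omega
        · rw [hval, chain_apply_mid (by omega) h0 (by omega)] at h1
          exact absurd h1.symm (letter_ne_both q)
    · obtain ⟨h1, h2, -, -⟩ := truncate_top (k := n + 1) (by omega) hw
        ⟨_, hd (n + 1), hlast0⟩ ho' hanti
      have h3 := h2 _ (hd (n + 1)) hlast0
      rw [← h3] at h1
      rcases Nat.lt_or_ge x n with h | h
      · rw [hlast h] at h1
        obtain rfl := letter_injective h1
        exact Or.inr (Or.inl (Prod.ext (add_right_cancel h3).symm rfl))
      · rw [hlast' (by omega)] at h1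
        exact absurd h1.symm (letter_ne_both q)
  · obtain ⟨-, h2, h3, -⟩ := truncate_bottom (k := n + 2) (by omega) (by omega) hw
      ⟨_, rfl, by rw [hfirst]; exact letter_ne_zero _⟩ ho hanti
    have h4 := h3 _ rfl (by rw [hfirst]; exact letter_ne_zero _)
    rw [← h4, hfirst] at h2
    exact Or.inl (Prod.ext h4.symm (letter_injective h2).symm)

omit [NeZero L] in
lemma TeeValues.anti_side {w : Site L} {p : Bool} {i x : ℕ} {τ : Cfg L}
    (hT : TeeValues n w p i x τ) : Anti τ (sideSite w p (i + x)) (turn p (i + x + 1)) := by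
  unfold Anti
  rw [sideSite_add_step, hT.side, hT.foot, detect_letter, zero_add, detect_add]
  have h : detect (turn p (i + x + 1)) (letter (turn p (i + x))) = 1 := detect_letter_not _
  split
  · rw [h, detect_zero, add_zero]
  · rw [h, detect_letter, add_zero]

omit [NeZero L] in
lemma TeeValues.anti_first (hn : 1 ≤ n) (hL : n + 2 < L) {w : Site L} {p : Bool} {i x : ℕ}
    {τ : Cfg L} (hT : TeeValues n w p i x τ) :
    Anti τ (stairSite w p i) (turn p i) ↔ x ≠ 0 := by
  have h0 := hT.other 0 (by omega) (by omega)
  rw [add_zero, chain_apply_first (by omega)] at h0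
  unfold Anti
  rw [h0, detect_letter, zero_add]
  change detect _ (τ (stairSite w p (i + 1))) = 1 ↔ _
  rcases Nat.eq_zero_or_pos x with rfl | hx
  · have := hT.foot
    rw [if_pos (by omega), add_zero, add_zero] at this
    simp [this, detect_letter]
  · rw [hT.other 1 (by omega) (by omega), chain_apply_mid (by omega) (by omega) (by omega),
      detect_both]
    simpa using hx.ne'

omit [NeZero L] in
lemma TeeValues.anti_last (hn : 1 ≤ n) (hL : n + 2 < L) {w : Site L} {p : Bool} {i x : ℕ}
    (hx : x ≤ n) {τ : Cfg L} (hT : TeeValues n w p i x τ) :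
    Anti τ (stairSite w p (i + n)) (turn p (i + n)) ↔ x ≠ n := by
  unfold Anti
  change _ + detect _ (τ (stairSite w p (i + (n + 1)))) = 1 ↔ _
  rcases Nat.lt_or_ge x n with hxn | hxn
  · rw [hT.other (n + 1) (by omega) (by omega)]
    rw [show chain w p i (n + 1) (stairSite w p (i + (n + 1))) = letter (turn p (i + n)) from
      chain_apply_last (by omega), detect_letter, add_zero]
    have hval : detect (turn p (i + n)) (τ (stairSite w p (i + n))) = 1 := by
      rcases Nat.lt_or_ge (x + 1) n with h | h
      · rw [hT.other n (by omega) (by omega), chain_apply_mid (by omega) (by omega) (by omega),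
          detect_both]
      · obtain rfl : n = x + 1 := by omega
        have := hT.foot
        rw [if_pos hxn, add_zero] at this
        rw [← add_assoc, this]
        exact detect_letter_not _
    simpa [hval] using hxn.ne
  · obtain rfl : x = n := by omega
    have h1 := hT.foot
    rw [if_neg (lt_irrefl _)] at h1
    replace h1 : τ (stairSite w p (i + (x + 1))) = (1, 1) := h1.trans (letter_add_letter_not _)
    rw [h1, hT.other x (by omega) (by omega), chain_apply_mid (by omega) (by omega) (by omega),
      detect_both]
    simp only [ne_eq, not_true_eq_false, iff_false]
    decide

/-- The relation that comes from a chain of at least two bonds with a bond that sticks out. -/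
lemma Conserved.tee_relation (hC : Conserved L (n + 2) J r) (hkL : 2 * (n + 2) ≤ L) (hn : 1 ≤ n)
    (w : Site L) (p : Bool) {i x : ℕ} (hx : x ≤ n) :
    (if x ≠ 0 then J (turn p i) * r (chain w p (i + 1) n + sideBond w p (i + x)) else 0) +
      (if x ≠ n then J (turn p (i + n)) * r (chain w p i n + sideBond w p (i + x)) else 0) +
      J (turn p (i + x + 1)) * r (chain w p i (n + 1)) = 0 := by
  have hT := teeValues (L := L) (n := n) (i := i) (by omega) w p hx
  have hne : ∀ y ≤ n + 1, (sideSite w p (i + x), turn p (i + x + 1)) ≠ stairBond w p (i + y) :=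
    fun y hy e => sideSite_ne (by omega) w p (by omega) (by omega) (congrArg Prod.fst e)
  have hS := hC.sum_eq_zero (τ := chain w p i (n + 1) + sideBond w p (i + x))
    {stairBond w p i, stairBond w p (i + n), (sideSite w p (i + x), turn p (i + x + 1))} (by
      intro γ hγ
      simpa using hC.tee_mem hkL hx hγ)
  rw [Finset.sum_insert, Finset.sum_pair (hne n (by omega)).symm, ← add_assoc] at hS
  · have e1 : chain w p i (n + 1) + sideBond w p (i + x) + bond (stairSite w p i) (turn p i) =
        chain w p (i + 1) n + sideBond w p (i + x) := by
      rw [chain_succ', add_assoc (bond _ _), add_comm (bond _ _), add_bond_self]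
    have e2 : chain w p i (n + 1) + sideBond w p (i + x) +
        bond (stairSite w p (i + n)) (turn p (i + n)) =
        chain w p i n + sideBond w p (i + x) := by
      rw [chain_succ, add_right_comm _ (bond _ _), add_bond_self]
    have e3 : chain w p i (n + 1) + sideBond w p (i + x) +
        bond (sideSite w p (i + x)) (turn p (i + x + 1)) = chain w p i (n + 1) :=
      add_bond_self _ _ _
    rw [term_of_anti hT.anti_side, e3] at hS
    simp only [term, stairBond, hT.anti_first hn (by omega), hT.anti_last hn (by omega) hx,
      e1, e2] at hS
    exact hS
  · simp only [Finset.mem_insert, Finset.mem_singleton, not_or]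
    exact ⟨stairBond_ne (i := i) (x := 0) (by omega) (by omega) (by omega),
      (hne 0 (by omega)).symm⟩

/-- Two bonds with a common upper end have proportional coefficients. -/
lemma Conserved.corner_relation (hC : Conserved L 2 J r) (hkL : 4 ≤ L) (w : Site L) (p : Bool) :
    J p * r (bond (w + step L p - step L (!p)) (!p)) + J (!p) * r (bond w p) = 0 := by
  have hT := teeValues (L := L) (n := 0) (i := 0) (x := 0) (by omega) w p le_rfl
  have hS := hC.sum_eq_zero (τ := chain w p 0 1 + sideBond w p 0)
    {stairBond w p 0, (sideSite w p 0, turn p 1)} (by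
      intro γ hγ
      simpa using Conserved.tee_mem (n := 0) (i := 0) (x := 0) hC (by omega) le_rfl hγ)
  have hc : chain w p 0 1 = bond w p := by
    rw [chain_succ, chain_zero, zero_add]; rfl
  rw [Finset.sum_pair fun e => sideSite_ne (L := L) (by omega) w p (i := 0) (x := 0) (y := 0)
    (by omega) (by omega) (congrArg Prod.fst e).symm,
    term_of_anti hT.anti_side, stairBond, term_of_anti] at hS
  · have e1 : chain w p 0 1 + sideBond w p 0 + bond (stairSite w p 0) (turn p 0) =
        bond (w + step L p - step L (!p)) (!p) := by
      rw [hc, add_comm (bond w p)]; exact add_bond_self _ _ _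
    have e2 : chain w p 0 1 + sideBond w p 0 + bond (sideSite w p 0) (turn p 1) = bond w p := by
      rw [hc]; exact add_bond_self _ _ _
    rw [e1] at hS
    simp only [zero_add, e2] at hS
    exact hS
  · have h0 := hT.other 0 (by omega) (by omega)
    rw [add_zero, chain_apply_first (by omega)] at h0
    have h1 := hT.foot
    rw [if_neg (by omega)] at h1
    unfold Anti
    rw [h0, detect_letter, zero_add]
    change detect _ ((chain w p 0 (0 + 1) + sideBond w p (0 + 0)) (stairSite w p (0 + 0 + 1))) = 1
    rw [h1]
    exact (congrArg _ (letter_add_letter_not p)).trans (detect_both p)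

end Relations

/-- The chain relations and the relations with a fixed bond that sticks out force the chain
coefficients to vanish. -/
lemma eq_zero_of_chain_relations {J R F : ℕ → ℂ} {n : ℕ} {c : ℂ} (hJ : ∀ i, J i ≠ 0) (hc : c ≠ 0)
    (hn : 1 ≤ n) (hR : ∀ i, J i * R (i + 1) + J (i + n + 1) * R i = 0)
    (hfirst : J 0 * F 1 + c * R 0 = 0)
    (hmid : ∀ i, 0 < i → i < n → J i * F (i + 1) + J (i + n) * F i + c * R i = 0)
    (hlast : J (n + n) * F n + c * R n = 0) : R 0 = 0 := by
  set G : ℕ → ℂ := fun j => ∏ t ∈ Finset.range j, J t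
  have hG : ∀ j, G (j + 1) = G j * J j := fun j => Finset.prod_range_succ J j
  have hG0 : G 0 = 1 := Finset.prod_range_zero J
  have hGne : ∀ j, G j ≠ 0 := fun j => Finset.prod_ne_zero_iff.2 fun i _ => hJ i
  have hRG : ∀ i, R i * G i * G (n + 1) = (-1) ^ i * G (i + n + 1) * R 0 := by
    intro i
    induction i with
    | zero => rw [hG0, zero_add, pow_zero]; ring
    | succ i ih =>
      rw [hG i, show i + 1 + n + 1 = i + n + 1 + 1 by omega, hG (i + n + 1), pow_succ]
      linear_combination G i * G (n + 1) * hR i - J (i + n + 1) * ih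
  have hFG : ∀ i, i + 1 ≤ n →
      F (i + 1) * G (i + 1) * G (n + 1) =
        (-1) ^ (i + 1) * (i + 1) * c * G (i + 1 + n) * R 0 := by
    intro i
    induction i with
    | zero =>
      intro _
      rw [hG 0, hG0, zero_add, add_comm 1 n]
      push_cast
      linear_combination G (n + 1) * hfirst
    | succ i ih =>
      intro hi
      have ih := ih (by omega)
      have h1 := hRG (i + 1)
      have h2 := hmid (i + 1) (by omega) (by omega)
      rw [hG (i + 1), show i + 1 + 1 + n = i + 1 + n + 1 by omega]
      rw [hG (i + 1 + n)] at h1 ⊢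
      rw [pow_succ _ (i + 1)]
      push_cast
      linear_combination G (i + 1) * G (n + 1) * h2 - J (i + 1 + n) * ih - c * h1
  obtain ⟨m, rfl⟩ := Nat.exists_eq_add_of_le' hn
  have h1 := hFG m le_rfl
  have h2 := hRG (m + 1)
  rw [hG (m + 1 + (m + 1))] at h2
  have h3 : (-1) ^ (m + 1) * ((m : ℂ) + 2) * c * G (m + 1 + (m + 1)) *
      J (m + 1 + (m + 1)) * R 0 = 0 := by
    linear_combination G (m + 1) * G (m + 1 + 1) * hlast - J (m + 1 + (m + 1)) * h1 - c * h2
  have hm : (m : ℂ) + 2 ≠ 0 := by exact_mod_cast (Nat.succ_ne_zero (m + 1))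
  simpa [hc, hGne, hJ, hm] using h3

section Consequences

variable {L : ℕ} [NeZero L] {J : Bool → ℂ} {r : Cfg L → ℂ} {n : ℕ}

/-- Products of length at least three do not occur. -/
lemma Conserved.eq_zero_of_long (hC : Conserved L (n + 2) J r) (hkL : 2 * (n + 2) ≤ L)
    (hn : 1 ≤ n) {A : Cfg L} {a : ZMod L} (h1 : Occ A a)
    (h2 : Occ A (a + ((n + 1 : ℕ) : ZMod L))) : r A = 0 := by
  by_contra h
  obtain ⟨w, p, -, rfl⟩ := hC.eq_chain hkL h h1 h2
  refine h (eq_zero_of_chain_relations (J := fun i => J (turn p i))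
    (R := fun i => r (chain w p i (n + 1))) (F := fun i => r (chain w p i n + sideBond w p n))
    (c := J (turn p (n + 1))) (fun i => hC.coupling _) (hC.coupling _) hn
    (hC.chain_shift hkL w p) ?_ ?_ ?_)
  · have := hC.tee_relation hkL hn w p (i := 0) (x := n) le_rfl
    simpa [show n ≠ 0 by omega] using this
  · intro i h0 hi
    have := hC.tee_relation hkL hn w p (i := i) (x := n - i) (by omega)
    simpa [show i + (n - i) = n by omega, show n - i ≠ 0 by omega, show n - i ≠ n by omega]
      using this
  · have := hC.tee_relation hkL hn w p (i := n) (x := 0) (by omega)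
    simpa [show 0 ≠ n by omega] using this

/-- Coefficients of bonds related by a translation by a lattice vector agree. -/
lemma Conserved.bond_coeff (hC : Conserved L 2 J r) (hkL : 4 ≤ L) :
    ∃ c : ℂ, ∀ u, r (bond u false) = c * J false ∧ r (bond u true) = -c * J true := by
  have hlink : ∀ w p, J p * r (bond (w + step L p) (!p)) + J (!p) * r (bond w p) = 0 := by
    intro w p
    have := Conserved.chain_shift (n := 0) hC (by omega) w p 0
    simp only [chain_succ, chain_zero, zero_add] at this
    exact this
  have hcorner := fun w p => hC.corner_relation hkL w p
  have hJ := hC.coupling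
  have hstep : ∀ u p, r (bond (u + step L p) false) = r (bond u false) := by
    intro u p
    refine mul_left_cancel₀ (hJ true) ?_
    cases p
    · have h1 := hcorner u false
      have h2 := hlink (u + step L false - step L true) true
      rw [sub_add_cancel] at h2
      exact add_left_cancel ((add_comm _ _).trans (h2.trans h1.symm))
    · have h1 := hlink u false
      have h2 := hcorner (u + step L false) true
      rw [Bool.not_true, add_right_comm, add_sub_cancel_right] at h2
      exact add_left_cancel ((add_comm _ _).trans (h2.trans h1.symm))
  have hconst : ∀ u, r (bond u false) = r (bond 0 false) := by
    have h1 : ∀ (m : ℕ) u p, r (bond (u + m • step L p) false) = r (bond u false) := by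
      intro m u p
      induction m with
      | zero => simp
      | succ m ih => rw [succ_nsmul, ← add_assoc, hstep, ih]
    intro u
    have : u = 0 + u.1.val • step L false + u.2.val • step L true := by
      ext <;> simp [step]
    rw [this, h1, h1]
  refine ⟨r (bond 0 false) / J false, fun u => ⟨?_, ?_⟩⟩
  · rw [hconst u, div_mul_cancel₀ _ (hJ false)]
  · have := hlink (u - step L false) false
    rw [hconst (u - step L false), sub_add_cancel] at this
    have h0 := hJ false
    field_simp
    simp only [Bool.not_false] at this
    linear_combination this

/-- Products on a single diagonal other than the identity do not occur. -/
lemma Conserved.eq_zero_of_single (hC : Conserved L 1 J r) (hL : 2 ≤ L) (h0 : r 0 = 0)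
    (A : Cfg L) : r A = 0 := by
  by_contra hA
  have hsingle : ∀ {τ}, r τ ≠ 0 → ∀ {s t}, τ s ≠ 0 → τ t ≠ 0 → diagOf s = diagOf t := by
    intro τ hτ s t hs ht
    obtain ⟨a, ha⟩ := hC.within τ hτ
    obtain ⟨m, hm, hm'⟩ := ha s hs
    obtain ⟨m', hn, hn'⟩ := ha t ht
    rw [hm', hn', show m = 0 by omega, show m' = 0 by omega]
  have h10 := one_ne_zero_of_lt (L := L) (by omega)
  obtain ⟨u, hu⟩ : ∃ u, A u ≠ 0 := by
    by_contra! hc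
    exact hA ((congrArg r (funext hc)).trans h0)
  obtain ⟨p, hp⟩ := exists_detect hu
  have hdv : diagOf (u + step L p) ≠ diagOf u := by rw [diagOf_add_step]; simpa using h10
  have hAv : A (u + step L p) = 0 := by
    by_contra h
    exact hdv (hsingle hA h hu)
  set τ := A + bond u p with hτ
  have hτu : detect p (τ u) = 1 := by rw [hτ, detect_add_bond, hp]
  have hτv : τ (u + step L p) = letter p := by
    rw [hτ, Pi.add_apply, hAv, bond_apply_right, zero_add]
  have hτo : ∀ s, s ≠ u → s ≠ u + step L p → τ s = A s := fun s h h' => by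
    rw [hτ, Pi.add_apply, bond_apply_eq_zero h h', add_zero]
  have hval : ∀ γ, term J r τ γ = 0 ∨ term J r τ γ = J p * r A := by
    rintro ⟨g, q⟩
    by_cases hγ : term J r τ (g, q) = 0
    · exact Or.inl hγ
    right
    obtain ⟨hanti, hr⟩ := term_ne_zero hγ
    rw [term_of_anti hanti]
    suffices q = p ∧ bond g q = bond u p by
      rw [this.2, this.1, hτ, add_bond_self]
    unfold Anti at hanti
    dsimp only at hanti hr
    by_cases hv : (τ + bond g q) (u + step L p) = 0
    · obtain ⟨h1, h2⟩ := emptied (by rw [hτv]; exact letter_ne_zero p) hv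
      obtain rfl := letter_injective (hτv.symm.trans h1)
      refine ⟨rfl, ?_⟩
      rcases h2 with rfl | h2
      · have hback : u + step L p + step L p = u := by
          by_contra hne
          rw [hτv, detect_letter, zero_add, hτo _ hne (add_step_ne (by omega) _ _)] at hanti
          have := hsingle hA (ne_zero_of_detect hanti) hu
          rw [diagOf_add_step, diagOf_add_step, add_assoc, add_eq_left] at this
          refine hne ?_
          rw [add_assoc, add_eq_left]
          cases p <;> ext <;> simp [step, this]
        funext s
        simp only [bond, hback, or_comm (a := s = u)]
      · rw [add_right_cancel h2]
    · exfalso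
      have hu' : (τ + bond g q) u = 0 := by
        by_contra h
        exact hdv (hsingle hr hv h)
      obtain ⟨h1, h2⟩ := emptied (ne_zero_of_detect hτu) hu'
      rw [h1] at hτu
      obtain rfl := eq_not_of_detect_letter hτu
      rcases h2 with rfl | h2
      · rw [h1, detect_letter, zero_add, hτo _ (add_step_ne (by omega) _ _) fun e => by
          simpa using step_injective (by omega) (add_left_cancel e)] at hanti
        have := hsingle hA (ne_zero_of_detect hanti) hu
        rw [diagOf_add_step, add_eq_left] at this
        exact h10 this
      · rw [← h2, h1, detect_letter, add_zero, hτo g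
          (fun e => add_step_ne (by omega) _ _ (h2.symm.trans e.symm)) (fun e => by
            rw [e, add_assoc, left_eq_add] at h2
            have := congrArg Prod.fst h2
            cases p <;> simp [step, h10] at this)] at hanti
        have := hsingle hA (ne_zero_of_detect hanti) hu
        rw [h2, diagOf_add_step, left_eq_add] at this
        exact h10 this
  have hx : J p * r A ≠ 0 := mul_ne_zero (hC.coupling p) hA
  have hmain : term J r τ (u, p) = J p * r A := by
    rw [term_of_anti, hτ, add_bond_self]
    unfold Anti
    rw [hτu, hτv, detect_letter, add_zero]
  have hsum := hC.eqn τ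
  rw [← Finset.sum_filter_ne_zero, Finset.sum_congr rfl fun γ hγ =>
    (hval γ).resolve_left (Finset.mem_filter.1 hγ).2, Finset.sum_const, smul_eq_zero,
    Finset.card_eq_zero] at hsum
  refine hsum.elim (fun h => ?_) hx
  have hmem : (u, p) ∈ Finset.univ.filter fun γ => term J r τ γ ≠ 0 := by
    simpa [hmain] using hx
  rw [h] at hmem
  simp at hmem

end Consequences

/-- The matrix `X ^ x.1 * Y ^ x.2`. -/
noncomputable def letterMat (x : Letter) : Matrix (Fin 2) (Fin 2) ℂ :=
  (if x.1 = 1 then pauli 1 else 1) * (if x.2 = 1 then pauli 2 else 1)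

/-- The character `(-1) ^ x`. -/
noncomputable def sgn (x : ZMod 2) : ℂ := if x = 1 then -1 else 1

lemma ZMod.two_eq_zero_or_one (x : ZMod 2) : x = 0 ∨ x = 1 := by revert x; decide

lemma sgn_zero : sgn 0 = 1 := by simp [sgn]

lemma sgn_add (x y : ZMod 2) : sgn (x + y) = sgn x * sgn y := by
  rcases ZMod.two_eq_zero_or_one x with rfl | rfl <;>
    rcases ZMod.two_eq_zero_or_one y with rfl | rfl <;>
    simp [sgn, show (1 : ZMod 2) + 1 = 0 from rfl]

lemma pauli_two_mul_one : pauli 2 * pauli 1 = -(pauli 1 * pauli 2) := by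
  ext i j; fin_cases i <;> fin_cases j <;> simp [pauli]

lemma pauli_one_mul_self : pauli 1 * pauli 1 = 1 := by
  ext i j; fin_cases i <;> fin_cases j <;> simp [pauli]

lemma pauli_two_mul_self : pauli 2 * pauli 2 = 1 := by
  ext i j; fin_cases i <;> fin_cases j <;> simp [pauli]

lemma letterMat_mul (x y : Letter) :
    letterMat x * letterMat y = sgn (x.2 * y.1) • letterMat (x + y) := by
  have h11 := pauli_one_mul_self
  have h22 := pauli_two_mul_self
  have h21 := pauli_two_mul_one
  have h1 : ∀ M, pauli 1 * (pauli 1 * M) = M := fun M => by rw [← mul_assoc, h11, one_mul]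
  have h3 : ∀ M, pauli 2 * (pauli 1 * M) = -(pauli 1 * (pauli 2 * M)) := fun M => by
    rw [← mul_assoc, h21, neg_mul, mul_assoc]
  obtain ⟨x1, x2⟩ := x
  obtain ⟨y1, y2⟩ := y
  rcases ZMod.two_eq_zero_or_one x1 with rfl | rfl <;>
    rcases ZMod.two_eq_zero_or_one x2 with rfl | rfl <;>
    rcases ZMod.two_eq_zero_or_one y1 with rfl | rfl <;>
    rcases ZMod.two_eq_zero_or_one y2 with rfl | rfl <;>
    simp [letterMat, sgn, show (1 : ZMod 2) + 1 = 0 from rfl, mul_assoc, h11, h22, h21, h1, h3]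

lemma letterMat_zero : letterMat 0 = 1 := by simp [letterMat]

lemma trace_letterMat {x : Letter} (h : x ≠ 0) : (letterMat x).trace = 0 := by
  obtain ⟨x1, x2⟩ := x
  rcases ZMod.two_eq_zero_or_one x1 with rfl | rfl <;>
    rcases ZMod.two_eq_zero_or_one x2 with rfl | rfl
  · exact absurd rfl h
  all_goals simp [letterMat, pauli, Matrix.trace]

section Operators

variable {L : ℕ} [NeZero L]

/-- The product of the matrices `letterMat (τ u)`. -/
noncomputable def cfgOp (τ : Cfg L) : Op L := fun s t => ∏ u, letterMat (τ u) (s u) (t u)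

lemma cfgOp_mul (τ τ' : Cfg L) :
    cfgOp τ * cfgOp τ' = (∏ u, sgn ((τ u).2 * (τ' u).1)) • cfgOp (τ + τ') := by
  ext s t
  rw [Matrix.mul_apply, Matrix.smul_apply, smul_eq_mul]
  simp only [cfgOp]
  rw [← Finset.prod_mul_distrib]
  simp only [← Finset.prod_mul_distrib]
  rw [← Fintype.piFinset_univ, ← Finset.prod_univ_sum (fun _ => Finset.univ)
    (fun u j => letterMat (τ u) (s u) j * letterMat (τ' u) j (t u))]
  refine Finset.prod_congr rfl fun u _ => ?_
  rw [← Matrix.mul_apply, letterMat_mul, Matrix.smul_apply, smul_eq_mul, Pi.add_apply]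

lemma trace_cfgOp (τ : Cfg L) : (cfgOp τ).trace = ∏ u, (letterMat (τ u)).trace := by
  simp only [Matrix.trace, Matrix.diag, cfgOp]
  rw [← Fintype.piFinset_univ, ← Finset.prod_univ_sum (fun _ => Finset.univ)
    (fun u j => letterMat (τ u) j j)]

lemma sgn_ne_zero (x : ZMod 2) : sgn x ≠ 0 := by unfold sgn; split <;> simp

lemma eq_zero_of_sum_cfgOp_eq_zero {c : Cfg L → ℂ} (h : ∑ τ, c τ • cfgOp τ = 0) (σ : Cfg L) :
    c σ = 0 := by
  have h1 : (cfgOp σ * ∑ τ, c τ • cfgOp τ).trace = 0 := by rw [h]; simp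
  rw [Finset.mul_sum, Matrix.trace_sum, Finset.sum_eq_single σ] at h1
  · rw [Matrix.mul_smul, cfgOp_mul, Matrix.trace_smul, Matrix.trace_smul, trace_cfgOp] at h1
    simp only [smul_eq_mul, mul_eq_zero, Finset.prod_eq_zero_iff] at h1
    rcases h1 with h1 | ⟨u, -, h1⟩ | ⟨u, -, h1⟩
    · exact h1
    · exact absurd h1 (sgn_ne_zero _)
    · rw [Pi.add_apply, letter_add_self, letterMat_zero] at h1
      simp at h1
  · intro τ _ hτ
    rw [Matrix.mul_smul, cfgOp_mul, Matrix.trace_smul, Matrix.trace_smul, trace_cfgOp]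
    obtain ⟨u, hu⟩ := Function.ne_iff.1 hτ
    have h0 : ∏ v, (letterMat ((σ + τ) v)).trace = 0 :=
      Finset.prod_eq_zero (Finset.mem_univ u)
        (trace_letterMat fun e => hu (eq_of_add_letter_eq_zero e).symm)
    rw [h0, smul_zero, smul_zero]
  · simp

lemma prod_bond (hL : 1 < L) (u : Site L) (p : Bool) {f : Letter → Letter → ℂ} (τ : Cfg L)
    (hf : ∀ x, f x 0 = 1) :
    ∏ s, f (τ s) (bond u p s) =
      f (τ u) (letter p) * f (τ (u + step L p)) (letter p) := by
  rw [Finset.prod_eq_mul u (u + step L p) (add_step_ne hL u p).symm _ (by simp) (by simp),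
    bond_apply_left, bond_apply_right]
  exact fun s _ hs => by rw [bond_apply_eq_zero hs.1 hs.2, hf]

/-- The sign of the coupling in the commutator with a bond. -/
noncomputable def bondSign (p : Bool) : ℂ := if p then -1 else 1

open Classical in
lemma comm_bond (hL : 1 < L) (u : Site L) (p : Bool) (τ : Cfg L) :
    opComm L (cfgOp (bond u p)) (cfgOp τ) =
      (if Anti τ u p then 2 * bondSign p else 0) • cfgOp (τ + bond u p) := by
  rw [opComm, cfgOp_mul, cfgOp_mul, add_comm (bond u p), ← sub_smul]
  congr 1
  rw [prod_bond hL u p τ (f := fun x y => sgn (y.2 * x.1)) (by simp [sgn_zero]),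
    prod_bond hL u p τ (f := fun x y => sgn (x.2 * y.1)) (by simp [sgn_zero]),
    ← sgn_add, ← sgn_add]
  unfold Anti
  cases p <;> simp only [letter, detect, bondSign, if_true, Bool.false_eq_true, if_false, one_mul,
    zero_mul, mul_one, mul_zero, add_zero, sgn_zero]
  · rcases ZMod.two_eq_zero_or_one ((τ u).2 + (τ (u + step L false)).2) with h | h <;>
      simp [h, sgn]
    norm_num
  · rcases ZMod.two_eq_zero_or_one ((τ u).1 + (τ (u + step L true)).1) with h | h <;>
      simp [h, sgn]
    norm_num

lemma comm_sum (hL : 1 < L) (K : Bool → ℂ) (r : Cfg L → ℂ) :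
    opComm L (-∑ β : Site L × Bool, K β.2 • cfgOp (bond β.1 β.2)) (∑ τ, r τ • cfgOp τ) =
      ∑ τ, (-2 * ∑ β, term (fun p => bondSign p * K p) r τ β) • cfgOp τ := by
  have h1 : opComm L (-∑ β : Site L × Bool, K β.2 • cfgOp (bond β.1 β.2)) (∑ τ, r τ • cfgOp τ) =
      -∑ β : Site L × Bool, ∑ τ, (K β.2 * r τ) • opComm L (cfgOp (bond β.1 β.2)) (cfgOp τ) := by
    simp only [opComm, smul_sub, neg_mul, mul_neg, Finset.sum_sub_distrib, Finset.sum_mul_sum,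
      smul_mul_smul_comm]
    rw [Finset.sum_comm (s := (Finset.univ : Finset (Cfg L)))]
    simp only [mul_comm (r _)]
    abel
  rw [h1]
  have h2 : ∀ β : Site L × Bool,
      ∑ τ, (K β.2 * r τ) • opComm L (cfgOp (bond β.1 β.2)) (cfgOp τ) =
        ∑ τ, (2 * term (fun p => bondSign p * K p) r τ β) • cfgOp τ := by
    intro β
    rw [← Equiv.sum_comp (Equiv.addRight (bond β.1 β.2))]
    refine Finset.sum_congr rfl fun τ _ => ?_
    rw [Equiv.coe_addRight, comm_bond hL, add_bond_self, anti_add_bond, smul_smul, term]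
    congr 1
    split <;> ring
  rw [Finset.sum_congr rfl fun β _ => h2 β, Finset.sum_comm, ← Finset.sum_neg_distrib]
  refine Finset.sum_congr rfl fun τ _ => ?_
  rw [← Finset.sum_smul, ← Finset.mul_sum, neg_mul, neg_smul]

end Operators

/-- The exponents of `X` and `Y` in a Pauli matrix. -/
def letterEquiv : Fin 4 ≃ Letter where
  toFun := ![0, (1, 0), (0, 1), (1, 1)]
  invFun x := if x = 0 then 0 else if x = (1, 0) then 1 else if x = (0, 1) then 2 else 3
  left_inv := by decide
  right_inv := by decide

lemma letterEquiv_eq_zero {w : Fin 4} : letterEquiv w = 0 ↔ w = 0 := by revert w; decide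

/-- The scalar that relates `pauli` and `letterMat`. -/
noncomputable def phase (w : Fin 4) : ℂ := if w = 3 then -Complex.I else 1

lemma phase_ne_zero (w : Fin 4) : phase w ≠ 0 := by unfold phase; split <;> simp

lemma pauli_eq (w : Fin 4) : pauli w = phase w • letterMat (letterEquiv w) := by
  fin_cases w
  · simp [pauli, phase, letterMat, letterEquiv]
  · simp [phase, letterMat, letterEquiv]
  · simp [phase, letterMat, letterEquiv]
  · ext i j; fin_cases i <;> fin_cases j <;> simp [pauli, phase, letterMat, letterEquiv]

section Occupation

variable {L : ℕ} {τ : Cfg L} {a : ZMod L} {n : ℕ}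

lemma Within.mono {m : ℕ} (h : Within τ a n) (hnm : n ≤ m) : Within τ a m := fun u hu => by
  obtain ⟨i, hi, hi'⟩ := h u hu
  exact ⟨i, by omega, hi'⟩

lemma Within.of_not_occ_bottom (h : Within τ a (n + 1)) (ho : ¬ Occ τ a) :
    Within τ (a + 1) n := fun u hu => by
  obtain ⟨i, hi, hi'⟩ := h u hu
  rcases i with _ | i
  · exact absurd ⟨u, by simpa using hi', hu⟩ ho
  · exact ⟨i, by omega, by rw [hi']; push_cast; ring⟩

lemma Within.of_not_occ_top (h : Within τ a (n + 1)) (ho : ¬ Occ τ (a + (n : ZMod L))) :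
    Within τ a n := fun u hu => by
  obtain ⟨i, hi, hi'⟩ := h u hu
  rcases Nat.lt_or_ge i n with hin | hin
  · exact ⟨i, hin, hi'⟩
  · obtain rfl : i = n := by omega
    exact absurd ⟨u, hi', hu⟩ ho

lemma bond_within (u : Site L) (p : Bool) : Within (bond u p) (diagOf u) 2 := fun s hs => by
  by_cases h : s = u
  · exact ⟨0, by omega, by simp [h]⟩
  by_cases h' : s = u + step L p
  · exact ⟨1, by omega, by rw [h', diagOf_add_step, Nat.cast_one]⟩
  · exact absurd (bond_apply_eq_zero h h') hs

lemma bond_ne_zero (u : Site L) (p : Bool) : bond u p ≠ 0 := fun h => by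
  have := congrFun h u
  rw [bond_apply_left] at this
  exact letter_ne_zero p this

lemma bond_injective (hL : 2 < L) {u v : Site L} {p q : Bool} (h : bond u p = bond v q) :
    u = v ∧ p = q := by
  have h1 := congrFun h u
  have h2 := congrFun h v
  rw [bond_apply_left, bond] at h1
  rw [bond_apply_left, bond] at h2
  split at h1
  on_goal 2 => exact absurd h1 (letter_ne_zero p)
  split at h2
  on_goal 2 => exact absurd h2.symm (letter_ne_zero q)
  rename_i h3 h4
  refine ⟨?_, letter_injective h1⟩
  rcases h3 with h3 | h3
  · exact h3
  rcases h4 with h4 | h4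
  · exact h4.symm
  exfalso
  have h5 := congrArg diagOf h4
  rw [h3, diagOf_add_step, diagOf_add_step, add_assoc, left_eq_add] at h5
  have := cast_inj_of_lt (L := L) (m := 2) (n := 0) hL (by omega) (by push_cast; rw [← h5]; ring)
  omega

lemma diagBoundAt_iff [NeZero L] {σ : PSpec L} {k : ℕ} :
    DiagBoundAt L σ a k ↔ Within (letterEquiv ∘ σ) a k := by
  refine forall_congr' fun u => ?_
  rw [Function.comp_apply, Ne, Ne, letterEquiv_eq_zero]
  refine imp_congr_right fun _ => ⟨fun h => ⟨_, h, ?_⟩, ?_⟩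
  · rw [ZMod.natCast_zmod_val, diagOf]; ring
  · rintro ⟨m, hm, h⟩
    rw [diagOf] at h
    rw [h, add_sub_cancel_left, ZMod.val_natCast]
    exact (Nat.mod_le m L).trans_lt hm

lemma exists_within_diag [NeZero L] (σ : PSpec L) : ∃ a, Within (letterEquiv ∘ σ) a (Diag L σ) := by
  have h : Diag L σ ∈ {k | ∃ a : ZMod L, DiagBoundAt L σ a k} :=
    Nat.sInf_mem ⟨L, 0, fun u _ => ZMod.val_lt _⟩
  obtain ⟨a, ha⟩ := h
  exact ⟨a, diagBoundAt_iff.1 ha⟩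

lemma diag_le [NeZero L] {σ : PSpec L} {k : ℕ} (h : Within (letterEquiv ∘ σ) a k) :
    Diag L σ ≤ k :=
  Nat.sInf_le ⟨a, diagBoundAt_iff.2 h⟩

lemma exists_occ_of_diag [NeZero L] {σ : PSpec L} (h : Diag L σ = n + 1) :
    ∃ a, Occ (letterEquiv ∘ σ) a ∧ Occ (letterEquiv ∘ σ) (a + (n : ZMod L)) := by
  obtain ⟨a, ha⟩ := exists_within_diag σ
  rw [h] at ha
  refine ⟨a, ?_, ?_⟩ <;> by_contra ho
  · have := diag_le (ha.of_not_occ_bottom ho)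
    omega
  · have := diag_le (ha.of_not_occ_top ho)
    omega

end Occupation

section Bridge

variable {L : ℕ} [NeZero L]

/-- The coefficients of `Qop L q` with respect to the products `cfgOp τ`. -/
noncomputable def coeff (q : PSpec L → ℂ) (τ : Cfg L) : ℂ :=
  q (letterEquiv.symm ∘ τ) * ∏ u, phase (letterEquiv.symm (τ u))

lemma pauliOp_eq (σ : PSpec L) :
    PauliOp L σ = (∏ u, phase (σ u)) • cfgOp (letterEquiv ∘ σ) := by
  ext s t
  rw [Matrix.smul_apply, smul_eq_mul, PauliOp, cfgOp, ← Finset.prod_mul_distrib]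
  refine Finset.prod_congr rfl fun u _ => ?_
  rw [pauli_eq, Matrix.smul_apply, smul_eq_mul, Function.comp_apply]

lemma qop_eq (q : PSpec L → ℂ) : Qop L q = ∑ τ, coeff q τ • cfgOp τ := by
  rw [Qop, ← Equiv.sum_comp ((Equiv.refl (Site L)).arrowCongr letterEquiv)]
  refine Finset.sum_congr rfl fun σ _ => ?_
  rw [pauliOp_eq, smul_smul, coeff]
  congr 2
  · congr 1
    funext u
    simp
  · refine Finset.prod_congr rfl fun u _ => ?_
    simp

lemma coeff_ne_zero {q : PSpec L → ℂ} {τ : Cfg L} :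
    coeff q τ ≠ 0 ↔ q (letterEquiv.symm ∘ τ) ≠ 0 := by
  rw [coeff, mul_ne_zero_iff, and_iff_left]
  exact Finset.prod_ne_zero_iff.2 fun u _ => phase_ne_zero _

lemma pauliOp_sigXX (u : Site L) : PauliOp L (sigXX L u) = cfgOp (bond u false) := by
  rw [pauliOp_eq, Finset.prod_eq_one, one_smul]
  · congr 1
    funext s
    simp only [Function.comp_apply, sigXX, bond, step]
    by_cases h : s = u <;> by_cases h' : s = u + (1, 0) <;> simp [h, h', letterEquiv, letter]
  · intro s _
    unfold sigXX phase
    split_ifs <;> simp_all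

lemma pauliOp_sigYY (u : Site L) : PauliOp L (sigYY L u) = cfgOp (bond u true) := by
  rw [pauliOp_eq, Finset.prod_eq_one, one_smul]
  · congr 1
    funext s
    simp only [Function.comp_apply, sigYY, bond, step]
    by_cases h : s = u <;> by_cases h' : s = u + (0, 1) <;> simp [h, h', letterEquiv, letter]
  · intro s _
    unfold sigYY phase
    split_ifs <;> simp_all

/-- The coupling constant of a bond. -/
noncomputable def coupling (Jx Jy : ℝ) (p : Bool) : ℂ := if p then (Jy : ℂ) else (Jx : ℂ)

lemma hcompass_eq (Jx Jy : ℝ) :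
    Hcompass L Jx Jy = -∑ β : Site L × Bool, coupling Jx Jy β.2 • cfgOp (bond β.1 β.2) := by
  refine congrArg Neg.neg (Eq.trans ?_ (Fintype.sum_prod_type _).symm)
  refine Finset.sum_congr rfl fun u _ => ?_
  rw [Fintype.sum_bool, pauliOp_sigXX, pauliOp_sigYY, add_comm]
  rfl

open Classical in
/-- The coefficients of a bond Hamiltonian. -/
noncomputable def bondCoeff (K : Bool → ℂ) (τ : Cfg L) : ℂ :=
  ∑ β : Site L × Bool, if τ = bond β.1 β.2 then K β.2 else 0

lemma sum_bondCoeff (K : Bool → ℂ) :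
    ∑ τ : Cfg L, bondCoeff K τ • cfgOp τ = ∑ β : Site L × Bool, K β.2 • cfgOp (bond β.1 β.2) := by
  simp only [bondCoeff, Finset.sum_smul, ite_smul, zero_smul]
  rw [Finset.sum_comm]
  simp

lemma exists_bond_of_bondCoeff_ne_zero {K : Bool → ℂ} {τ : Cfg L} (h : bondCoeff K τ ≠ 0) :
    ∃ u p, τ = bond u p := by
  obtain ⟨β, -, hβ⟩ := Finset.exists_ne_zero_of_sum_ne_zero h
  exact ⟨β.1, β.2, by by_contra hc; exact hβ (if_neg hc)⟩

lemma bondCoeff_bond (hL : 2 < L) (K : Bool → ℂ) (u : Site L) (p : Bool) :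
    bondCoeff K (bond u p) = K p := by
  rw [bondCoeff, Finset.sum_eq_single (u, p)]
  · simp
  · intro β _ hβ
    refine if_neg fun h => hβ ?_
    obtain ⟨h1, h2⟩ := bond_injective hL h
    exact Prod.ext h1.symm h2.symm
  · simp

lemma Conserved.of_comm {k : ℕ} {K : Bool → ℂ} {r : Cfg L → ℂ} (hL : 1 < L) (hK : ∀ p, K p ≠ 0)
    (h : opComm L (-∑ β : Site L × Bool, K β.2 • cfgOp (bond β.1 β.2)) (∑ τ, r τ • cfgOp τ) = 0)
    (hw : ∀ τ, r τ ≠ 0 → ∃ a, Within τ a k) :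
    Conserved L k (fun p => bondSign p * K p) r where
  coupling p := mul_ne_zero (by cases p <;> simp [bondSign]) (hK p)
  eqn τ := by
    rw [comm_sum hL] at h
    simpa using eq_zero_of_sum_cfgOp_eq_zero h τ
  within := hw

/-- A conserved quantity of length two is a multiple of the Hamiltonian. -/
lemma eq_mul_bondCoeff (hL : 4 ≤ L) {K : Bool → ℂ} (hK : ∀ p, K p ≠ 0) {r : Cfg L → ℂ}
    (h : opComm L (-∑ β : Site L × Bool, K β.2 • cfgOp (bond β.1 β.2)) (∑ τ, r τ • cfgOp τ) = 0)
    (hw : ∀ τ, r τ ≠ 0 → ∃ a, Within τ a 2) (h0 : r 0 = 0) :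
    ∃ c, ∀ τ, r τ = c * bondCoeff K τ := by
  have hC := Conserved.of_comm (by omega) hK h hw
  obtain ⟨c, hc⟩ := hC.bond_coeff hL
  have hbond : ∀ u p, r (bond u p) = c * K p := by
    intro u p
    cases p
    · simpa [bondSign] using (hc u).1
    · simpa [bondSign] using (hc u).2
  refine ⟨c, fun τ => ?_⟩
  have hsub : ∑ τ, (r τ - c * bondCoeff K τ) • cfgOp τ =
      ∑ τ, r τ • cfgOp τ - c • ∑ β : Site L × Bool, K β.2 • cfgOp (bond β.1 β.2) := by
    simp only [sub_smul, Finset.sum_sub_distrib, mul_smul, ← sum_bondCoeff, Finset.smul_sum]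
  have hC' : Conserved L 1 (fun p => bondSign p * K p) (fun τ => r τ - c * bondCoeff K τ) := by
    refine Conserved.of_comm (by omega) hK ?_ fun σ hσ => ?_
    · rw [hsub]
      rw [opComm] at h ⊢
      rw [mul_sub, sub_mul, sub_sub_sub_comm, h]
      simp
    · have hmain : (∃ a, Within σ a 2) ∧
          ∀ a, Occ σ a → Occ σ (a + ((0 + 1 : ℕ) : ZMod L)) → ∃ u p, σ = bond u p := by
        by_cases hr : r σ = 0
        · have hb : bondCoeff K σ ≠ 0 := by
            intro hb
            rw [hr, hb] at hσ
            simp at hσ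
          obtain ⟨u, p, rfl⟩ := exists_bond_of_bondCoeff_ne_zero hb
          exact ⟨⟨_, bond_within u p⟩, fun _ _ _ => ⟨u, p, rfl⟩⟩
        · refine ⟨hw σ hr, fun a h1 h2 => ?_⟩
          obtain ⟨w, p, -, hA⟩ := Conserved.eq_chain (n := 0) hC (by omega) hr h1 h2
          refine ⟨w, p, hA.trans ?_⟩
          rw [chain_succ, chain_zero, zero_add]
          rfl
      obtain ⟨⟨a, ha⟩, hb⟩ := hmain
      by_cases h1 : Occ σ a
      · by_cases h2 : Occ σ (a + ((0 + 1 : ℕ) : ZMod L))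
        · obtain ⟨u, p, rfl⟩ := hb a h1 h2
          rw [hbond, bondCoeff_bond (by omega), sub_self] at hσ
          exact absurd rfl hσ
        · exact ⟨a, ha.of_not_occ_top h2⟩
      · exact ⟨a + 1, ha.of_not_occ_bottom h1⟩
  refine sub_eq_zero.1 (hC'.eq_zero_of_single (by omega) ?_ τ)
  have : bondCoeff K (0 : Cfg L) = 0 := by
    by_contra hne
    obtain ⟨u, p, hb⟩ := exists_bond_of_bondCoeff_ne_zero hne
    exact bond_ne_zero u p hb.symm
  rw [h0, this, mul_zero, sub_zero]

end Bridge

/-- For `1 ≤ k̄ ≤ L/2`, every local conserved quantity of the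
quantum compass Hamiltonian with diagonal length `k̄` is a nonzero constant
multiple of `H`; in particular this forces `k̄ = 2`. -/
theorem compass_no_nontrivial_local_conserved_quantities
    (L : ℕ) [NeZero L] (Jx Jy : ℝ) (hJx : Jx ≠ 0) (hJy : Jy ≠ 0)
    (k : ℕ) (hk1 : 1 ≤ k) (hkL : 2 * k ≤ L)
    (q : PSpec L → ℂ)
    (hsupp : ∀ σ : PSpec L, q σ ≠ 0 → σ ≠ 0 ∧ Diag L σ ≤ k)
    (hmax : ∃ σ : PSpec L, Diag L σ = k ∧ q σ ≠ 0)
    (hcons : opComm L (Hcompass L Jx Jy) (Qop L q) = 0) :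
    (∃ c : ℂ, c ≠ 0 ∧ Qop L q = c • Hcompass L Jx Jy) ∧ k = 2 := by
  have hK : ∀ p, coupling Jx Jy p ≠ 0 := by
    intro p
    cases p <;> simp [coupling, hJx, hJy]
  rw [qop_eq, hcompass_eq] at hcons ⊢
  have hw : ∀ τ, coeff q τ ≠ 0 → ∃ a, Within τ a k := by
    intro τ hτ
    obtain ⟨a, ha⟩ := exists_within_diag (letterEquiv.symm ∘ τ)
    rw [← Function.comp_assoc, Equiv.self_comp_symm, Function.id_comp] at ha
    exact ⟨a, ha.mono (hsupp _ (coeff_ne_zero.1 hτ)).2⟩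
  have h0 : coeff q 0 = 0 := by
    by_contra h
    refine (hsupp _ (coeff_ne_zero.1 h)).1 (funext fun u => ?_)
    rw [Function.comp_apply, Pi.zero_apply, Equiv.symm_apply_eq]
    rfl
  obtain ⟨σ, hσ, hqσ⟩ := hmax
  have hr : coeff q (letterEquiv ∘ σ) ≠ 0 := by
    rw [coeff_ne_zero, ← Function.comp_assoc, Equiv.symm_comp_self, Function.id_comp]
    exact hqσ
  rcases Nat.lt_or_ge k 2 with hk | hk
  · obtain rfl : k = 1 := by omega
    have hC := Conserved.of_comm (by omega) hK hcons hw
    exact absurd (hC.eq_zero_of_single (by omega) h0 _) hr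
  obtain ⟨n, rfl⟩ := Nat.exists_eq_add_of_le' hk
  rcases Nat.eq_zero_or_pos n with rfl | hn
  · refine ⟨?_, rfl⟩
    obtain ⟨c, hc⟩ := eq_mul_bondCoeff (by omega) hK hcons hw h0
    refine ⟨-c, ?_, ?_⟩
    · rw [neg_ne_zero]
      rintro rfl
      exact hr (by rw [hc, zero_mul])
    · simp only [hc, mul_smul]
      rw [← Finset.smul_sum, sum_bondCoeff, neg_smul, smul_neg, neg_neg]
  · have hC := Conserved.of_comm (by omega) hK hcons hw
    obtain ⟨a, h1, h2⟩ := exists_occ_of_diag (n := n + 1) hσ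
    exact absurd (hC.eq_zero_of_long hkL hn h1 h2) hr
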